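/- Let n > 8, let S̃_n be Schur's double cover of S_n with projection π, and let (ρ, V) be an irreducible spin representation of S̃_n with dim_ℂ V = 2^{⌊(n−1)/2⌋} (a basic spin representation). Let g ∈ S̃_n with k = k(g) the order of π(g), and assume π(g) has a cycle of length 3 and a cycle of length 5, and every other cycle of π(g) (fixed points counted as cycles of length 1) has length divisible by neither 3 nor 5. Then 15 divides k and the minimal polynomial p(X) of ρ(g) satisfies p(X) · (X^{k/3} − ε_g) · (X^{k/5} − ε_g) = (X^k − ε_g) · (X^{k/15} − ε_g). -/

import Mathlib

/-!
Schur's double cover `S̃_N` of the symmetric group, presented by generators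
`z, t_1, …, t_{N-1}` and relations `z² = 1`, `t_i² = z`, `(t_i t_{i+1})³ = z`,
`(t_i t_j)² = z` for `|i − j| ≥ 2`.

Generators are indexed by `Option (Fin (N-1))`: `none` is the central element `z`
and `some i` is `t_{i+1}` (so `some i` for `i = 0, …, N-2` are `t_1, …, t_{N-1}`).
-/

abbrev SchurGen (N : ℕ) := Option (Fin (N - 1))

namespace Schur

/-- The relator `z` as an element of the free group. -/
def zf (N : ℕ) : FreeGroup (SchurGen N) := FreeGroup.of none

/-- The generator `t_{i+1}` as an element of the free group. -/
def tf (N : ℕ) (i : Fin (N - 1)) : FreeGroup (SchurGen N) := FreeGroup.of (some i)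

/-- The defining relators of Schur's double cover. -/
def rels (N : ℕ) : Set (FreeGroup (SchurGen N)) :=
  { r | r = zf N ^ 2 ∨
        (∃ i, r = tf N i ^ 2 * (zf N)⁻¹) ∨
        (∃ i j : Fin (N - 1), (i : ℕ) + 1 = (j : ℕ) ∧
          r = (tf N i * tf N j) ^ 3 * (zf N)⁻¹) ∨
        (∃ i j : Fin (N - 1), ((i : ℕ) + 2 ≤ (j : ℕ) ∨ (j : ℕ) + 2 ≤ (i : ℕ)) ∧
          r = (tf N i * tf N j) ^ 2 * (zf N)⁻¹) }

/-- Schur's double cover `S̃_N` of the symmetric group `S_N`. -/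
abbrev Cover (N : ℕ) := PresentedGroup (rels N)

/-- The central element `z` of `S̃_N`. -/
def z (N : ℕ) : Cover N := PresentedGroup.of none

/-- The generator `t_{i+1}` of `S̃_N` (0-indexed). -/
def t (N : ℕ) (i : Fin (N - 1)) : Cover N := PresentedGroup.of (some i)

/-- The generator `t_i` of `S̃_N`, 1-indexed: meaningful for `1 ≤ i ≤ N-1`
(junk value `1` outside this range). -/
def T (N i : ℕ) : Cover N := if h : i - 1 < N - 1 then t N ⟨i - 1, h⟩ else 1

/-- The product `t_a t_{a+1} ⋯ t_{a+n-1}` (`n` consecutive generators, 1-indexed). -/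
def P (N a n : ℕ) : Cover N := ((List.range n).map fun j => T N (a + j)).prod

end Schur


/-- The adjacent transposition `(i, i+1)` of `{1, …, n}`: in 0-indexed terms, for
`i : Fin (n-1)` this is the swap of `i` and `i+1` in `Fin n`.  It is the image of the
generator `t_{i+1}` under the canonical projection `S̃_n → S_n`. -/
def Schur.adj (n : ℕ) (i : Fin (n - 1)) : Equiv.Perm (Fin n) :=
  Equiv.swap ⟨i.1, by have := i.2; omega⟩ ⟨i.1 + 1, by have := i.2; omega⟩

section TwistedS4

variable {R : Type*} [Ring R] {a b c : R}

/-- `3` times the idempotent onto the fixed space of the order three element `-ab`, where `a`, `b`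
are the images of two consecutive generators of a double cover. -/
def tripleFix (a b : R) : R := 1 - a * b - b * a

/-- Left-multiplied forms of the relations of the twisted group algebra of `S₄`, oriented as a
confluent rewriting system on right-associated words. -/
theorem twisted_rewrite_rules (ha : a * a = -1) (hb : b * b = -1) (hc : c * c = -1)
    (hab : a * b * a = b * a * b) (hbc : b * c * b = c * b * c) (hac : a * c = -(c * a)) :
    (∀ x, a * (a * x) = -x) ∧ (∀ x, b * (b * x) = -x) ∧ (∀ x, c * (c * x) = -x) ∧
    (b * (a * b) = a * (b * a)) ∧ (∀ x, b * (a * (b * x)) = a * (b * (a * x))) ∧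
    (c * (b * c) = b * (c * b)) ∧ (∀ x, c * (b * (c * x)) = b * (c * (b * x))) ∧
    (c * a = -(a * c)) ∧ (∀ x, c * (a * x) = -(a * (c * x))) ∧
    (c * (b * (a * c)) = -(b * (c * (b * a)))) ∧
    (∀ x, c * (b * (a * (c * x))) = -(b * (c * (b * (a * x))))) := by
  have h1 : b * (a * b) = a * (b * a) := by rw [← mul_assoc, ← hab, mul_assoc]
  have h2 : c * (b * c) = b * (c * b) := by rw [← mul_assoc, ← hbc, mul_assoc]
  have h2' : ∀ x, c * (b * (c * x)) = b * (c * (b * x)) := fun x => by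
    simpa only [mul_assoc] using congrArg (· * x) h2
  have h3 : c * a = -(a * c) := by rw [hac, neg_neg]
  have h4 : c * (b * (a * c)) = -(b * (c * (b * a))) := by rw [hac, mul_neg, mul_neg, h2']
  refine ⟨fun x => ?_, fun x => ?_, fun x => ?_, h1, fun x => ?_, h2, h2', h3, fun x => ?_, h4,
    fun x => ?_⟩
  · rw [← mul_assoc, ha, neg_one_mul]
  · rw [← mul_assoc, hb, neg_one_mul]
  · rw [← mul_assoc, hc, neg_one_mul]
  · simpa only [mul_assoc] using congrArg (· * x) h1
  · simpa only [mul_assoc, neg_mul] using congrArg (· * x) h3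
  · simpa only [mul_assoc, neg_mul] using congrArg (· * x) h4

theorem tripleFix_mul_self (ha : a * a = -1) (hb : b * b = -1)
    (hab : a * b * a = b * a * b) : tripleFix a b * tripleFix a b = 3 • tripleFix a b := by
  have ha' : ∀ x, a * (a * x) = -x := fun x => by rw [← mul_assoc, ha, neg_one_mul]
  have hb' : ∀ x, b * (b * x) = -x := fun x => by rw [← mul_assoc, hb, neg_one_mul]
  have h1 : b * (a * b) = a * (b * a) := by rw [← mul_assoc, ← hab, mul_assoc]
  have h1' : ∀ x, b * (a * (b * x)) = a * (b * (a * x)) := fun x => by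
    simpa only [mul_assoc] using congrArg (· * x) h1
  simp only [tripleFix, mul_assoc, mul_sub, sub_mul, ha', hb', h1, h1', mul_one, one_mul,
    mul_neg, ha, hb]
  abel

theorem mul_tripleFix_comm (ha : a * a = -1) :
    a * tripleFix a b = tripleFix a b * a := by
  have ha' : ∀ x, a * (a * x) = -x := fun x => by rw [← mul_assoc, ha, neg_one_mul]
  simp only [tripleFix, mul_assoc, mul_sub, sub_mul, ha', mul_one, one_mul, mul_neg, ha]
  abel

theorem tripleFix_compress (ha : a * a = -1) (hb : b * b = -1) (hc : c * c = -1)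
    (hab : a * b * a = b * a * b) (hbc : b * c * b = c * b * c) (hac : a * c = -(c * a)) :
    tripleFix a b * c * tripleFix a b * c * tripleFix a b = -(3 • tripleFix a b) := by
  obtain ⟨ha', hb', hc', h1, h1', h2, h2', h3, h3', h4, h4'⟩ :=
    twisted_rewrite_rules ha hb hc hab hbc hac
  simp only [tripleFix, mul_assoc, mul_sub, sub_mul, ha', hb', h1, h1', h2, h3, h3', h4,
    mul_one, one_mul, mul_neg, neg_mul, neg_neg, ha, hb, hc]
  abel

/-- The sum of (three times) the four `3`-cycle idempotents of `S̃₄`. -/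
def tripleFixSum (a b c : R) : R :=
  tripleFix a b - c * tripleFix a b * c + tripleFix b c - a * tripleFix b c * a

theorem tripleFixSum_mul_left (ha : a * a = -1) (hb : b * b = -1) (hc : c * c = -1)
    (hab : a * b * a = b * a * b) (hbc : b * c * b = c * b * c) (hac : a * c = -(c * a)) :
    tripleFixSum a b c * tripleFix a b = 6 • tripleFix a b := by
  obtain ⟨ha', hb', hc', h1, h1', h2, h2', h3, h3', h4, h4'⟩ :=
    twisted_rewrite_rules ha hb hc hab hbc hac
  simp only [tripleFixSum, tripleFix, mul_assoc, mul_sub, sub_mul, add_mul, ha', hb', h1, h1', h2,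
    h3, h3', h4, mul_one, one_mul, mul_neg, neg_mul, neg_neg, ha, hb, hc]
  abel

theorem tripleFixSum_mul_right (ha : a * a = -1) (hb : b * b = -1) (hc : c * c = -1)
    (hab : a * b * a = b * a * b) (hbc : b * c * b = c * b * c) (hac : a * c = -(c * a)) :
    tripleFixSum a b c * tripleFix b c = 6 • tripleFix b c := by
  obtain ⟨ha', hb', hc', h1, h1', h2, h2', h3, h3', h4, h4'⟩ :=
    twisted_rewrite_rules ha hb hc hab hbc hac
  simp only [tripleFixSum, tripleFix, mul_assoc, mul_sub, sub_mul, add_mul, ha', hb', hc', h1, h1',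
    h2, h2', h3, h3', h4, h4', mul_one, one_mul, mul_neg, neg_mul, neg_neg, ha, hb, hc]
  abel

end TwistedS4

section BasicFiveCycle

variable {R : Type*} [Ring R] {a b c d : R}

theorem basic_five_cycle (ha : a * a = -1) (hb : b * b = -1) (hc : c * c = -1) (hd : d * d = -1)
    (hab : a * b + b * a = 1) (hbc : b * c + c * b = 1) (hcd : c * d + d * c = 1)
    (hac : a * c = -(c * a)) (had : a * d = -(d * a)) (hbd : b * d = -(d * b)) :
    let y := a * b * c * d + d * c * b * a
    y * y = y + 1 := by
  have h1 : b * a = 1 - a * b := eq_sub_of_add_eq' hab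
  have h2 : c * b = 1 - b * c := eq_sub_of_add_eq' hbc
  have h3 : d * c = 1 - c * d := eq_sub_of_add_eq' hcd
  have h4 : c * a = -(a * c) := by rw [hac, neg_neg]
  have h5 : d * a = -(a * d) := by rw [had, neg_neg]
  have h6 : d * b = -(b * d) := by rw [hbd, neg_neg]
  have ext : ∀ {x y z : R}, x * y = z → ∀ w, x * (y * w) = z * w := fun h w => by
    rw [← mul_assoc, h]
  simp only [mul_assoc, mul_sub, sub_mul, mul_add, add_mul, mul_one, one_mul, mul_neg, neg_mul,
    neg_neg, ha, hb, hc, hd, h1, h3, h4, h5, h6, ext ha, ext hb, ext h1, ext h2,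
    ext h3, ext h4, ext h5, ext h6]
  abel

end BasicFiveCycle

section CliffordDimension

open Module

variable {V : Type*} [AddCommGroup V] [Module ℂ V]

theorem two_mul_finrank_le_of_disjoint_map [FiniteDimensional ℂ V] {U W : Submodule ℂ V}
    (h : V →ₗ[ℂ] V) (hinj : Function.Injective h) (hUW : ∀ x ∈ U, h x ∈ W) (hd : Disjoint U W) :
    finrank ℂ U ≤ finrank ℂ W ∧ 2 * finrank ℂ U ≤ finrank ℂ V := by
  have h1 : finrank ℂ U ≤ finrank ℂ W := by
    rw [(Submodule.equivMapOfInjective h hinj U).finrank_eq]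
    exact Submodule.finrank_mono (Submodule.map_le_iff_le_comap.2 hUW)
  have h2 := Submodule.finrank_add_finrank_le_of_disjoint hd
  omega

open Classical in
/-- The restriction of an endomorphism to an invariant subspace (zero if not invariant). -/
noncomputable def Module.End.res (U : Submodule ℂ V) (f : End ℂ V) : End ℂ U :=
  if h : ∀ x ∈ U, f x ∈ U then f.restrict h else 0

theorem Module.End.coe_res {U : Submodule ℂ V} {f : End ℂ V} (h : ∀ x ∈ U, f x ∈ U) (x : U) :
    (f.res U x : V) = f x := by
  rw [Module.End.res, dif_pos h, LinearMap.coe_restrict_apply]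

theorem Module.End.res_mul_eq_neg {U : Submodule ℂ V} {f g : End ℂ V} (hf : ∀ x ∈ U, f x ∈ U)
    (hg : ∀ x ∈ U, g x ∈ U) (h : f * g = -(g * f)) :
    f.res U * g.res U = -(g.res U * f.res U) := by
  ext x
  simpa [coe_res hf, coe_res hg] using LinearMap.congr_fun h (x : V)

theorem Module.End.res_mul_self {U : Submodule ℂ V} {f : End ℂ V} (hf : ∀ x ∈ U, f x ∈ U) {q : ℂ}
    (h : ∀ x ∈ U, f (f x) = q • x) : f.res U * f.res U = q • 1 := by
  ext x
  simpa [coe_res hf] using h x x.2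

theorem mem_of_commute_ker {f g : End ℂ V} {s : ℂ} (h : g * f = f * g) :
    ∀ x ∈ LinearMap.ker (f - s • 1), g x ∈ LinearMap.ker (f - s • 1) := by
  intro x hx
  simp only [LinearMap.mem_ker, LinearMap.sub_apply, LinearMap.smul_apply, End.one_apply,
    sub_eq_zero] at hx ⊢
  have := LinearMap.congr_fun h x
  simp only [End.mul_apply] at this
  rw [← this, hx, map_smul]

theorem injective_of_mul_self {f : End ℂ V} {q : ℂ} (hq : q ≠ 0) (h : f * f = q • 1) :
    Function.Injective f := by
  intro x y hxy
  have hx := LinearMap.congr_fun h x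
  have hy := LinearMap.congr_fun h y
  simp only [End.mul_apply, LinearMap.smul_apply, End.one_apply] at hx hy
  rw [hxy, hy] at hx
  exact (smul_right_injective V hq hx).symm

theorem two_pow_le_finrank_of_anticommute (N : ℕ) {V : Type*} [AddCommGroup V] [Module ℂ V]
    [FiniteDimensional ℂ V] [Nontrivial V] (A : ℕ → End ℂ V) (q : ℕ → ℂ)
    (hq : ∀ i < N, q i ≠ 0) (hA : ∀ i < N, A i * A i = q i • 1)
    (hAA : ∀ i j, i < j → j < N → A i * A j = -(A j * A i)) :
    2 ^ (N / 2) ≤ finrank ℂ V := by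
  induction N using Nat.twoStepInduction generalizing V with
  | zero => simpa using Nat.one_le_iff_ne_zero.2 (finrank_pos (R := ℂ) (M := V)).ne'
  | one => simpa using Nat.one_le_iff_ne_zero.2 (finrank_pos (R := ℂ) (M := V)).ne'
  | more N ih _ =>
    set a := A N
    set b := A (N + 1)
    have haa : a * a = q N • 1 := hA N (by omega)
    have hbb : b * b = q (N + 1) • 1 := hA (N + 1) (by omega)
    have hab : a * b = -(b * a) := hAA N (N + 1) (by omega) (by omega)
    have hqa := hq N (by omega)
    have hqb := hq (N + 1) (by omega)
    obtain ⟨s, hs⟩ := IsAlgClosed.exists_pow_nat_eq (-(q N * q (N + 1))) two_pos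
    have hs0 : s ≠ 0 := by
      rintro rfl
      simp [hqa, hqb] at hs
    set J := a * b with hJ
    have hba : b * a = -J := by rw [hab, neg_neg]
    have hJJ : J * J = (s * s) • 1 := by
      rw [← sq s, hs]
      calc J * J = a * (b * a) * b := by rw [hJ]; noncomm_ring
        _ = -((a * a) * (b * b)) := by rw [hba, hJ]; noncomm_ring
        _ = _ := by rw [haa, hbb, smul_mul_smul_comm, one_mul, neg_smul]
    have hJa : ∀ x, J (a x) = -(a (J x)) := fun x => by
      have : J * a = -(a * J) := by
        rw [← mul_neg, ← hba, hJ, mul_assoc]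
      simpa using LinearMap.congr_fun this x
    have hainj := injective_of_mul_self hqa haa
    set U := LinearMap.ker (J - s • 1) with hU
    have memU : ∀ x, x ∈ U ↔ J x = s • x := fun x => by simp [hU, sub_eq_zero]
    have hdim : 2 * finrank ℂ U ≤ finrank ℂ V := by
      refine (two_mul_finrank_le_of_disjoint_map (W := LinearMap.ker (J - (-s) • 1)) a hainj
        (fun x hx => ?_) ?_).2
      · rw [memU] at hx
        simp [hJa, hx]
      · rw [Submodule.disjoint_def]
        intro x hx hx'
        rw [memU] at hx
        simp only [LinearMap.mem_ker, LinearMap.sub_apply, LinearMap.smul_apply, End.one_apply,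
          sub_eq_zero, hx] at hx'
        have : (2 * s) • x = 0 := by rw [two_mul, add_smul]; nth_rw 1 [hx']; simp
        simpa [hs0] using this
    have : Nontrivial U := by
      obtain ⟨x, hx⟩ := exists_ne (0 : V)
      by_cases h : J x + s • x = 0
      · refine ⟨⟨⟨a x, ?_⟩, 0, fun h' => hx (hainj ?_)⟩⟩
        · rw [memU, hJa, eq_neg_of_add_eq_zero_left h]
          simp
        · simpa using h'
      · refine ⟨⟨⟨J x + s • x, ?_⟩, 0, fun h' => h ?_⟩⟩
        · have := LinearMap.congr_fun hJJ x
          simp only [End.mul_apply, LinearMap.smul_apply, End.one_apply] at this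
          rw [memU, map_add, map_smul, this, smul_add, smul_smul, add_comm]
        · simpa using h'
    have hcomm : ∀ i < N, A i * J = J * A i := fun i hi => by
      rw [hJ, ← mul_assoc, hAA i N hi (by omega), neg_mul, mul_assoc,
        hAA i (N + 1) (by omega) (by omega), mul_neg, neg_neg, mul_assoc]
    have hmaps : ∀ i < N, ∀ x ∈ U, A i x ∈ U := fun i hi => mem_of_commute_ker (hcomm i hi)
    have := ih (V := U) (fun i => (A i).res U) (fun i hi => hq i (by omega))
      (fun i hi => End.res_mul_self (hmaps i hi) fun x _ => by
        simpa using LinearMap.congr_fun (hA i (by omega)) x)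
      (fun i j hij hj => End.res_mul_eq_neg (hmaps i (by omega)) (hmaps j hj)
        (hAA i j hij (by omega)))
    rw [show (N + 2) / 2 = N / 2 + 1 by omega, pow_succ]
    omega

end CliffordDimension

section TripleFix

variable {R : Type*} [Ring R] {a b c : R}

theorem tripleFix_transport (hab : a * b * a = b * a * b) (hbc : b * c * b = c * b * c)
    (hac : a * c = -(c * a)) :
    a * b * c * a = -(b * (a * b * c)) ∧ a * b * c * b = -(c * (a * b * c)) ∧
      a * b * c * tripleFix a b = tripleFix b c * (a * b * c) := by
  have h1 : a * b * c * a = -(b * (a * b * c)) := by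
    calc a * b * c * a = a * b * (c * a) := by noncomm_ring
      _ = -(a * b * a * c) := by rw [← neg_eq_iff_eq_neg.2 hac]; noncomm_ring
      _ = _ := by rw [hab]; noncomm_ring
  have h2 : a * b * c * b = -(c * (a * b * c)) := by
    calc a * b * c * b = a * (b * c * b) := by noncomm_ring
      _ = a * c * b * c := by rw [hbc]; noncomm_ring
      _ = _ := by rw [hac]; noncomm_ring
  refine ⟨h1, h2, ?_⟩
  generalize a * b * c = h at *
  have e1 : h * (a * b) = b * c * h := by
    rw [← mul_assoc, h1, neg_mul, mul_assoc, h2, mul_neg, neg_neg, mul_assoc]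
  have e2 : h * (b * a) = c * b * h := by
    rw [← mul_assoc, h2, neg_mul, mul_assoc, h1, mul_neg, neg_neg, mul_assoc]
  simp only [tripleFix, mul_sub, sub_mul, e1, e2, mul_one, one_mul]

theorem tripleFix_comm_of_anticommute {g : R} (ha : a * g = -(g * a)) (hb : b * g = -(g * b)) :
    g * tripleFix a b = tripleFix a b * g := by
  have e1 : g * (a * b) = a * b * g := by
    rw [mul_assoc, hb, mul_neg, ← mul_assoc a, ha, neg_mul, neg_neg, mul_assoc]
  have e2 : g * (b * a) = b * a * g := by
    rw [mul_assoc, ha, mul_neg, ← mul_assoc b, hb, neg_mul, neg_neg, mul_assoc]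
  simp only [tripleFix, mul_sub, sub_mul, e1, e2, mul_one, one_mul]

theorem mul_mul_tripleFix (ha : a * a = -1) (hb : b * b = -1)
    (hab : a * b * a = b * a * b) : a * b * tripleFix a b = -tripleFix a b := by
  have e1 : a * b * (a * b) = -(b * a) := by
    rw [← mul_assoc, hab, mul_assoc, hb, mul_neg, mul_one]
  have e2 : a * b * (b * a) = 1 := by
    rw [mul_assoc, ← mul_assoc b, hb, neg_one_mul, mul_neg, ha, neg_neg]
  simp only [tripleFix, mul_sub, e1, e2, mul_one]
  abel

end TripleFix

section SpinSystem

open Module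

variable {V : Type*} [AddCommGroup V] [Module ℂ V]

theorem eq_zero_of_eq_neg_self {x : V} (h : x = -x) : x = 0 := by
  have : (2 : ℂ) • x = 0 := by rw [two_smul]; nth_rw 1 [h]; exact neg_add_cancel x
  simpa using this

/-- The eigenspace of `tripleFix a b` for the eigenvalue `3`. -/
abbrev tripleSpace (a b : End ℂ V) : Submodule ℂ V := LinearMap.ker (tripleFix a b - (3 : ℂ) • 1)

theorem mem_tripleSpace {a b : End ℂ V} {x : V} :
    x ∈ tripleSpace a b ↔ tripleFix a b x = (3 : ℂ) • x := by
  simp [tripleSpace, sub_eq_zero]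

theorem tripleSpace_apply_eq {a b : End ℂ V} (ha : a * a = -1) (hb : b * b = -1)
    (hab : a * b * a = b * a * b) {x : V} (hx : x ∈ tripleSpace a b) : b x = a x := by
  have h := LinearMap.congr_fun (mul_mul_tripleFix ha hb hab) x
  rw [mem_tripleSpace] at hx
  simp only [End.mul_apply, hx, map_smul, LinearMap.neg_apply, ← smul_neg] at h
  have h' := congrArg a (smul_right_injective V (three_ne_zero' ℂ) h)
  have ha' := LinearMap.congr_fun ha (b x)
  simp only [End.mul_apply, LinearMap.neg_apply, End.one_apply] at ha'
  rw [ha', map_neg, neg_inj] at h'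
  exact h'

theorem tripleSpace_ne_bot {a b : End ℂ V} (ha : a * a = -1) (hb : b * b = -1)
    (hab : a * b * a = b * a * b) (h0 : tripleFix a b ≠ 0) : Nontrivial (tripleSpace a b) := by
  obtain ⟨x, hx⟩ : ∃ x, tripleFix a b x ≠ 0 := by
    by_contra! h
    exact h0 (LinearMap.ext h)
  refine ⟨⟨⟨tripleFix a b x, ?_⟩, 0, fun h => hx (congrArg Subtype.val h)⟩⟩
  have := LinearMap.congr_fun (tripleFix_mul_self ha hb hab) x
  rw [mem_tripleSpace, ← End.mul_apply, this, ← Nat.cast_smul_eq_nsmul ℂ]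
  simp

theorem injective_of_sq_neg_one {f : End ℂ V} (h : f * f = -1) : Function.Injective f :=
  injective_of_mul_self (q := -1) (by simp) (by simpa using h)

theorem tripleSpace_disjoint [FiniteDimensional ℂ V] {a b c : End ℂ V}
    (ha : a * a = -1) (hb : b * b = -1)
    (hc : c * c = -1) (hab : a * b * a = b * a * b) (hbc : b * c * b = c * b * c)
    (hac : a * c = -(c * a)) : Disjoint (tripleSpace a b) (tripleSpace b c) ∧
      finrank ℂ (tripleSpace a b) ≤ finrank ℂ (tripleSpace b c) ∧
      2 * finrank ℂ (tripleSpace a b) ≤ finrank ℂ V := by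
  have hd : Disjoint (tripleSpace a b) (tripleSpace b c) := by
    rw [Submodule.disjoint_def]
    intro x hx hx'
    have h1 := tripleSpace_apply_eq ha hb hab hx
    have h2 := tripleSpace_apply_eq hb hc hbc hx'
    have h3 := LinearMap.congr_fun hac x
    have h4 := LinearMap.congr_fun ha x
    have h5 := LinearMap.congr_fun hc x
    simp only [End.mul_apply, LinearMap.neg_apply, End.one_apply] at h3 h4 h5
    rw [h2, h1, h4, ← h1, ← h2, h5, neg_neg] at h3
    exact eq_zero_of_eq_neg_self h3.symm
  obtain ⟨-, -, ht⟩ := tripleFix_transport hab hbc hac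
  refine ⟨hd, two_mul_finrank_le_of_disjoint_map (a * b * c)
    (((injective_of_sq_neg_one ha).comp (injective_of_sq_neg_one hb)).comp
      (injective_of_sq_neg_one hc)) (fun x hx => ?_) hd⟩
  have := LinearMap.congr_fun ht x
  rw [mem_tripleSpace] at hx ⊢
  rw [← End.mul_apply, ← this, End.mul_apply, hx, map_smul]

/-- Operators `T 0, …, T (N - 1)` satisfying the relations of a spin representation of a symmetric
group, with `r` further square roots `E j` of `-1` anticommuting with each other and with all
`T i`. -/
structure SpinSystem (N r : ℕ) (T E : ℕ → End ℂ V) : Prop where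
  T_sq : ∀ i < N, T i * T i = -1
  braid : ∀ i, i + 1 < N → T i * T (i + 1) * T i = T (i + 1) * T i * T (i + 1)
  far : ∀ i j, i + 2 ≤ j → j < N → T i * T j = -(T j * T i)
  E_sq : ∀ j < r, E j * E j = -1
  E_anti : ∀ i j, i < j → j < r → E i * E j = -(E j * E i)
  TE_anti : ∀ i j, i < N → j < r → T i * E j = -(E j * T i)

/-- The Gram–Schmidt orthogonalisation of the generators of a basic spin representation. -/
noncomputable def spinOrthogonal (T : ℕ → End ℂ V) : ℕ → End ℂ V
  | 0 => T 0
  | k + 1 => T (k + 1) + ((k + 1 : ℂ) / (k + 2)) • spinOrthogonal T k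

namespace SpinSystem

variable {N r : ℕ} {T E : ℕ → End ℂ V}

theorem tripleFix_eq_zero (hS : SpinSystem N r T E) (h0 : tripleFix (T 0) (T 1) = 0) (i : ℕ)
    (hi : i + 1 < N) : tripleFix (T i) (T (i + 1)) = 0 := by
  induction i with
  | zero => exact h0
  | succ i ih =>
    obtain ⟨-, -, ht⟩ := tripleFix_transport (hS.braid i (by omega)) (hS.braid (i + 1) hi)
      (hS.far i (i + 2) le_rfl (by omega))
    rw [ih (by omega), mul_zero] at ht
    have hx : ∀ i < N, ∀ x : End ℂ V, x * T i = 0 → x = 0 := fun i hi x h => by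
      have := congrArg (· * T i) h
      simpa [mul_assoc, hS.T_sq i hi] using this
    refine hx i (by omega) _ (hx (i + 1) (by omega) _ (hx (i + 2) (by omega) _ ?_))
    rw [ht]
    noncomm_ring

theorem spinOrthogonal_spec (hS : SpinSystem N r T E)
    (hT : ∀ i, i + 1 < N → T i * T (i + 1) + T (i + 1) * T i = 1) (k : ℕ) (hk : k < N) :
    spinOrthogonal T k * spinOrthogonal T k = (-((k + 2 : ℂ) / (2 * (k + 1)))) • 1 ∧
    (k + 1 < N → spinOrthogonal T k * T (k + 1) + T (k + 1) * spinOrthogonal T k = 1) ∧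
    (∀ m, k + 2 ≤ m → m < N → spinOrthogonal T k * T m + T m * spinOrthogonal T k = 0) ∧
    (∀ j < r, spinOrthogonal T k * E j + E j * spinOrthogonal T k = 0) ∧
    (∀ j < k, spinOrthogonal T j * spinOrthogonal T k +
      spinOrthogonal T k * spinOrthogonal T j = 0) := by
  induction k using Nat.strong_induction_on with
  | _ k ih =>
  have key : ∀ (x y w : End ℂ V) (α : ℂ),
      (y + α • x) * w + w * (y + α • x) = (y * w + w * y) + α • (x * w + w * x) := by
    intro x y w α
    simp only [add_mul, mul_add, smul_mul_assoc, mul_smul_comm, smul_add]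
    abel
  obtain _ | k := k
  · refine ⟨?_, fun h => hT 0 h, fun m hm hmN => ?_, fun j hj => ?_, by simp⟩
    · simpa [spinOrthogonal] using hS.T_sq 0 hk
    · simp [spinOrthogonal, hS.far 0 m hm hmN]
    · simp [spinOrthogonal, hS.TE_anti 0 j hk hj]
  · obtain ⟨i1, i2, i3, i4, i5⟩ := ih k (by omega) (by omega)
    specialize i2 hk
    have hk1 : (k + 1 : ℂ) ≠ 0 := by exact_mod_cast k.succ_ne_zero
    have hk2 : (k + 2 : ℂ) ≠ 0 := by exact_mod_cast (k + 1).succ_ne_zero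
    set F := spinOrthogonal T k
    have hF : spinOrthogonal T (k + 1) = T (k + 1) + ((k + 1 : ℂ) / (k + 2)) • F := rfl
    rw [hF]
    refine ⟨?_, fun h => ?_, fun m hm hmN => ?_, fun j hj => ?_, fun j hj => ?_⟩
    · calc _ = T (k + 1) * T (k + 1) +
            ((k + 1 : ℂ) / (k + 2)) • (F * T (k + 1) + T (k + 1) * F) +
            (((k + 1 : ℂ) / (k + 2)) * ((k + 1 : ℂ) / (k + 2))) • (F * F) := by
            simp only [add_mul, mul_add, smul_mul_assoc, mul_smul_comm, smul_add, smul_smul]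
            abel
        _ = _ := by
            rw [hS.T_sq _ hk, i2, i1, smul_smul, ← neg_one_smul ℂ (1 : End ℂ V), ← add_smul,
              ← add_smul]
            congr 1
            push_cast
            have hk3 : (k + 1 + 1 : ℂ) ≠ 0 := by
              rw [add_assoc]; norm_num; exact hk2
            field_simp
            ring
    · rw [key, hT _ h, i3 _ (by omega) h, smul_zero, add_zero]
    · rw [key, i3 m (by omega) hmN, smul_zero, add_zero, hS.far _ m hm hmN, neg_add_cancel]
    · rw [key, i4 j hj, smul_zero, add_zero, hS.TE_anti _ j hk hj, neg_add_cancel]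
    · rw [add_comm, key]
      obtain hj | rfl := Nat.lt_succ_iff_lt_or_eq.1 hj
      · rw [add_comm (F * _), i5 j hj, smul_zero, add_zero, add_comm]
        exact (ih j (by omega) (by omega)).2.2.1 _ (by omega) hk
      · rw [add_comm (T _ * _), i2, i1, ← two_smul ℂ, smul_smul, smul_smul]
        nth_rw 1 [← one_smul ℂ (1 : End ℂ V)]
        rw [← add_smul]
        convert zero_smul ℂ _
        field_simp
        ring

theorem two_pow_le_finrank_of_basic [FiniteDimensional ℂ V] [Nontrivial V]
    (hS : SpinSystem N r T E)
    (hT : ∀ i, i + 1 < N → T i * T (i + 1) + T (i + 1) * T i = 1) :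
    2 ^ ((N + r) / 2) ≤ finrank ℂ V := by
  refine two_pow_le_finrank_of_anticommute (N + r)
    (fun i => if i < N then spinOrthogonal T i else E (i - N))
    (fun i => if i < N then -((i + 2 : ℂ) / (2 * (i + 1))) else -1) (fun i hi => ?_)
    (fun i hi => ?_) (fun i j hij hj => ?_)
  · split_ifs with h
    · have hk1 : (i + 1 : ℂ) ≠ 0 := by exact_mod_cast i.succ_ne_zero
      have hk2 : (i + 2 : ℂ) ≠ 0 := by exact_mod_cast (i + 1).succ_ne_zero
      simp [hk1, hk2]
    · simp
  · split_ifs with h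
    · exact (hS.spinOrthogonal_spec hT i h).1
    · simpa using hS.E_sq (i - N) (by omega)
  · split_ifs with h1 h2 h2
    · exact eq_neg_of_add_eq_zero_left ((hS.spinOrthogonal_spec hT j h2).2.2.2.2 i hij)
    · exact eq_neg_of_add_eq_zero_left
        ((hS.spinOrthogonal_spec hT i h1).2.2.2.1 (j - N) (by omega))
    · omega
    · exact hS.E_anti _ _ (by omega) (by omega)

theorem of_restrict {U : Submodule ℂ V} (hTU : ∀ i < N, ∀ x ∈ U, T i x ∈ U)
    (hEU : ∀ j < r, ∀ x ∈ U, E j x ∈ U)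
    (T_sq : ∀ i < N, T i * T i = -1)
    (braid : ∀ i, i + 1 < N → T i * T (i + 1) * T i = T (i + 1) * T i * T (i + 1))
    (far : ∀ i j, i + 2 ≤ j → j < N → T i * T j = -(T j * T i))
    (E_sq : ∀ j < r, ∀ x ∈ U, E j (E j x) = -x)
    (E_anti : ∀ i j, i < j → j < r → E i * E j = -(E j * E i))
    (TE_anti : ∀ i j, i < N → j < r → T i * E j = -(E j * T i)) :
    SpinSystem N r (fun i => (T i).res U) (fun j => (E j).res U) where
  T_sq i hi := by
    ext x
    simpa [End.coe_res (hTU i hi)] using LinearMap.congr_fun (T_sq i hi) (x : V)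
  braid i hi := by
    ext x
    simpa [End.coe_res (hTU i (by omega)), End.coe_res (hTU (i + 1) hi)] using
      LinearMap.congr_fun (braid i hi) x
  far i j hij hj := End.res_mul_eq_neg (hTU i (by omega)) (hTU j hj) (far i j hij hj)
  E_sq j hj := by
    ext x
    simpa [End.coe_res (hEU j hj)] using E_sq j hj x x.2
  E_anti i j hij hj := End.res_mul_eq_neg (hEU i (by omega)) (hEU j hj) (E_anti i j hij hj)
  TE_anti i j hi hj := End.res_mul_eq_neg (hTU i hi) (hEU j hj) (TE_anti i j hi hj)

end SpinSystem

end SpinSystem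

section SpinSystem

open Module

namespace SpinSystem

theorem two_pow_le_finrank (N r : ℕ) (hN : N = 0 ∨ Odd N) {V : Type*} [AddCommGroup V]
    [Module ℂ V] [FiniteDimensional ℂ V] [Nontrivial V] {T E : ℕ → End ℂ V}
    (hS : SpinSystem N r T E) : 2 ^ ((N + r) / 2) ≤ finrank ℂ V := by
  induction N using Nat.strong_induction_on generalizing V r with
  | _ N ih =>
  obtain hN3 | hN3 : N ≤ 1 ∨ 3 ≤ N := by
    rcases hN with rfl | ⟨m, rfl⟩ <;> omega
  · exact hS.two_pow_le_finrank_of_basic fun i hi => by omega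
  have ha := hS.T_sq 0 (by omega)
  have hb := hS.T_sq 1 (by omega)
  have hc := hS.T_sq 2 (by omega)
  have hab := hS.braid 0 (by omega)
  have hbc := hS.braid 1 (by omega)
  have hac := hS.far 0 2 le_rfl (by omega)
  simp only [zero_add, one_add_one_eq_two] at hab hbc
  by_cases h0 : tripleFix (T 0) (T 1) = 0
  · refine hS.two_pow_le_finrank_of_basic fun i hi => ?_
    have := hS.tripleFix_eq_zero h0 i hi
    rw [tripleFix, sub_sub, sub_eq_zero] at this
    exact this.symm
  have hnt := tripleSpace_ne_bot ha hb hab h0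
  obtain ⟨-, -, hdim⟩ := tripleSpace_disjoint ha hb hc hab hbc hac
  obtain ⟨κ, hκ⟩ := IsAlgClosed.exists_pow_nat_eq (1 / 3 : ℂ) two_pos
  set f := tripleFix (T 0) (T 1) with hf
  set E' : ℕ → End ℂ V := fun j =>
    match j with
    | 0 => T 0
    | 1 => κ • (f * T 2)
    | j + 2 => E j with hE'
  have comm : ∀ g : End ℂ V, T 0 * g = -(g * T 0) → T 1 * g = -(g * T 1) → g * f = f * g :=
    fun g => tripleFix_comm_of_anticommute
  have commT : ∀ i, i + 4 < N → T (i + 4) * f = f * T (i + 4) := fun i hi =>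
    comm _ (hS.far 0 _ (by omega) hi) (hS.far 1 _ (by omega) hi)
  have commE : ∀ j < r, E j * f = f * E j := fun j hj =>
    comm _ (hS.TE_anti 0 _ (by omega) hj) (hS.TE_anti 1 _ (by omega) hj)
  have comm0 : T 0 * f = f * T 0 := mul_tripleFix_comm ha
  have anti : ∀ g : End ℂ V, g * f = f * g → g * T 2 = -(T 2 * g) →
      g * (κ • (f * T 2)) = -((κ • (f * T 2)) * g) := fun g h1 h2 => by
    rw [mul_smul_comm, smul_mul_assoc, ← smul_neg, ← mul_assoc, h1, mul_assoc, h2, mul_assoc,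
      mul_neg]
  have hsys : SpinSystem (N - 4) (r + 2) (fun i => (T (i + 4)).res (tripleSpace (T 0) (T 1)))
      (fun j => (E' j).res (tripleSpace (T 0) (T 1))) := by
    refine of_restrict (T := fun i => T (i + 4)) (fun i hi => ?_) ?_
      (fun i hi => hS.T_sq _ (by omega))
      (fun i hi => ?_)
      (fun i j hij hj => hS.far _ _ (by omega) (by omega)) ?_ ?_ ?_
    · exact mem_of_commute_ker (commT i (by omega))
    · rintro (_ | _ | j) hj
      · exact mem_of_commute_ker comm0
      · intro x hx
        rw [mem_tripleSpace]
        have := LinearMap.congr_fun (tripleFix_mul_self ha hb hab) (T 2 x)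
        rw [← Nat.cast_smul_eq_nsmul ℂ] at this
        simp only [End.mul_apply, LinearMap.smul_apply, ← hf] at this
        simp only [hE', ← hf, LinearMap.smul_apply, End.mul_apply, map_smul, this]
        rw [smul_comm]
        norm_num
      · exact mem_of_commute_ker (commE j (by omega))
    · have := hS.braid (i + 4) (by omega)
      rwa [add_right_comm] at this
    · rintro (_ | _ | j) hj x hx
      · exact LinearMap.congr_fun ha x
      · rw [mem_tripleSpace, ← hf] at hx
        have := LinearMap.congr_fun (tripleFix_compress ha hb hc hab hbc hac) x
        rw [← Nat.cast_smul_eq_nsmul ℂ] at this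
        simp only [End.mul_apply, LinearMap.smul_apply, ← hf, hx, map_smul, LinearMap.neg_apply,
          ← smul_neg] at this
        have h3 : ((3 : ℕ) : ℂ) = 3 := by norm_num
        rw [h3] at this
        have h' := smul_right_injective V (three_ne_zero' ℂ) this
        simp only [hE', LinearMap.smul_apply, End.mul_apply, map_smul, h']
        rw [smul_neg, smul_neg, smul_neg, smul_smul, smul_smul, ← sq, hκ]
        norm_num
      · exact LinearMap.congr_fun (hS.E_sq j (by omega)) x
    · rintro (_ | _ | i) (_ | _ | j) hij hj
      · omega
      · exact anti _ comm0 hac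
      · exact hS.TE_anti _ _ (by omega) (by omega)
      · omega
      · omega
      · refine eq_neg_iff_add_eq_zero.2 ?_
        rw [add_comm]
        refine eq_neg_iff_add_eq_zero.1 (anti _ (commE _ (by omega)) ?_)
        rw [hS.TE_anti 2 _ (by omega) (by omega), neg_neg]
      · omega
      · omega
      · exact hS.E_anti _ _ (by omega) (by omega)
    · rintro i (_ | _ | j) hi hj
      · rw [hS.far 0 (i + 4) (by omega) (by omega), neg_neg]
      · refine anti _ (commT i (by omega)) ?_
        rw [hS.far 2 (i + 4) (by omega) (by omega), neg_neg]
      · exact hS.TE_anti _ _ (by omega) (by omega)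
  have := ih (N - 4) (by omega) (r + 2) (by
    rcases hN with rfl | ⟨m, rfl⟩
    · omega
    · obtain hm | hm : m = 1 ∨ 2 ≤ m := by omega
      · left; omega
      · right; exact ⟨m - 2, by omega⟩) hsys
  calc 2 ^ ((N + r) / 2) ≤ 2 ^ ((N - 4 + (r + 2)) / 2 + 1) :=
        Nat.pow_le_pow_right two_pos (by rcases hN with rfl | ⟨m, rfl⟩ <;> omega)
    _ ≤ finrank ℂ V := by rw [pow_succ]; omega

/-- In a spin system of an even number `N` of generators and minimal dimension in which the
generators are not basic, `tripleSpace (T 0) (T 1)` and `tripleSpace (T 1) (T 2)` span. -/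
theorem tripleSpace_sup_eq_top {N : ℕ} (hN4 : 4 ≤ N) (hN : Even N) {V : Type*} [AddCommGroup V]
    [Module ℂ V] [FiniteDimensional ℂ V] {T E : ℕ → End ℂ V} (hS : SpinSystem N 0 T E)
    (hdim : finrank ℂ V ≤ 2 ^ (N / 2)) (h0 : tripleFix (T 0) (T 1) ≠ 0) :
    tripleSpace (T 0) (T 1) ⊔ tripleSpace (T 1) (T 2) = ⊤ := by
  have ha := hS.T_sq 0 (by omega)
  have hb := hS.T_sq 1 (by omega)
  have hc := hS.T_sq 2 (by omega)
  have hab := hS.braid 0 (by omega)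
  have hbc := hS.braid 1 (by omega)
  have hac := hS.far 0 2 le_rfl (by omega)
  simp only [zero_add, one_add_one_eq_two] at hab hbc
  have hnt := tripleSpace_ne_bot ha hb hab h0
  obtain ⟨hd, hle, -⟩ := tripleSpace_disjoint ha hb hc hab hbc hac
  have hsys : SpinSystem (N - 3) 1 (fun i => (T (i + 3)).res (tripleSpace (T 0) (T 1)))
      (fun _ => (T 0).res (tripleSpace (T 0) (T 1))) := by
    refine of_restrict (T := fun i => T (i + 3)) (E := fun _ => T 0) (fun i hi => ?_)
      (fun j hj => mem_of_commute_ker (mul_tripleFix_comm ha))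
      (fun i hi => hS.T_sq _ (by omega))
      (fun i hi => ?_)
      (fun i j hij hj => hS.far _ _ (by omega) (by omega))
      (fun j hj x _ => LinearMap.congr_fun ha x) (fun i j hij hj => by omega)
      (fun i j hi hj => ?_)
    · exact mem_of_commute_ker (tripleFix_comm_of_anticommute (hS.far 0 _ (by omega) (by omega))
        (hS.far 1 _ (by omega) (by omega)))
    · have := hS.braid (i + 3) (by omega)
      rwa [add_right_comm] at this
    · rw [hS.far 0 (i + 3) (by omega) (by omega), neg_neg]
  have h1 := two_pow_le_finrank (N - 3) 1
    (Or.inr (by obtain ⟨m, rfl⟩ := hN; exact ⟨m - 2, by omega⟩)) hsys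
  have h2 : (N - 3 + 1) / 2 + 1 = N / 2 := by obtain ⟨m, rfl⟩ := hN; omega
  rw [← h2, pow_succ] at hdim
  refine Submodule.eq_top_of_finrank_eq (le_antisymm (Submodule.finrank_le _) ?_)
  have := Submodule.finrank_sup_add_finrank_inf_eq (tripleSpace (T 0) (T 1))
    (tripleSpace (T 1) (T 2))
  rw [hd.eq_bot, finrank_bot] at this
  omega

theorem tripleFixSum_eq {N : ℕ} (hN4 : 4 ≤ N) (hN : Even N) {V : Type*} [AddCommGroup V]
    [Module ℂ V] [FiniteDimensional ℂ V] {T E : ℕ → End ℂ V} (hS : SpinSystem N 0 T E)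
    (hdim : finrank ℂ V ≤ 2 ^ (N / 2)) (h0 : tripleFix (T 0) (T 1) ≠ 0) :
    tripleFixSum (T 0) (T 1) (T 2) = (6 : ℂ) • 1 := by
  have htop := hS.tripleSpace_sup_eq_top hN4 hN hdim h0
  have ha := hS.T_sq 0 (by omega)
  have hb := hS.T_sq 1 (by omega)
  have hc := hS.T_sq 2 (by omega)
  have hab := hS.braid 0 (by omega)
  have hbc := hS.braid 1 (by omega)
  have hac := hS.far 0 2 le_rfl (by omega)
  simp only [zero_add, one_add_one_eq_two] at hab hbc
  have key : ∀ a b : End ℂ V, tripleFixSum (T 0) (T 1) (T 2) * tripleFix a b = 6 • tripleFix a b →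
      ∀ x ∈ tripleSpace a b, tripleFixSum (T 0) (T 1) (T 2) x = (6 : ℂ) • x := by
    intro a b h x hx
    rw [mem_tripleSpace] at hx
    have h' := LinearMap.congr_fun h x
    rw [← Nat.cast_smul_eq_nsmul ℂ, End.mul_apply, hx, map_smul, LinearMap.smul_apply, hx,
      smul_comm] at h'
    simpa using smul_right_injective V (three_ne_zero' ℂ) h'
  ext x
  obtain ⟨y, hy, w, hw, rfl⟩ := Submodule.mem_sup.1 (htop ▸ Submodule.mem_top : x ∈ _)
  simp [key _ _ (tripleFixSum_mul_left ha hb hc hab hbc hac) y hy,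
    key _ _ (tripleFixSum_mul_right ha hb hc hab hbc hac) w hw]

end SpinSystem

end SpinSystem

section CoxeterTypeA

variable {Q : Type*} [Group Q]

/-- The descending product `s m * s (m - 1) * ⋯` with `q` factors. -/
def descProd (s : ℕ → Q) (m : ℕ) : ℕ → Q
  | 0 => 1
  | q + 1 => descProd s m q * s (m - q)

variable {s : ℕ → Q} {N : ℕ}

theorem descProd_mul_of_lt (hfar : ∀ i j, i + 2 ≤ j → j < N → s i * s j = s j * s i) {m q i : ℕ}
    (hm : m < N) (hi : i + q < m) : descProd s m q * s i = s i * descProd s m q := by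
  induction q with
  | zero => simp [descProd]
  | succ q ih =>
    rw [descProd, mul_assoc, ← hfar i (m - q) (by omega) (by omega), ← mul_assoc, ih (by omega),
      mul_assoc]

theorem descProd_mul_of_gt (hbraid : ∀ i, i + 1 < N → s i * s (i + 1) * s i =
      s (i + 1) * s i * s (i + 1))
    (hfar : ∀ i j, i + 2 ≤ j → j < N → s i * s j = s j * s i) {m q i : ℕ} (hm : m < N)
    (hq : q ≤ m + 1) (hi : m < i + q) (him : i < m) :
    descProd s m q * s (i + 1) = s i * descProd s m q := by
  induction q with
  | zero => omega
  | succ q ih =>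
    obtain h | h : m = i + q ∨ m < i + q := by omega
    · obtain ⟨q, rfl⟩ : ∃ q', q = q' + 1 := ⟨q - 1, by omega⟩
      have e1 : m - q = i + 1 := by omega
      have e2 : m - (q + 1) = i := by omega
      have := descProd_mul_of_lt hfar hm (q := q) (i := i) (by omega)
      rw [descProd, descProd, e1, e2]
      calc _ = descProd s m q * (s (i + 1) * s i * s (i + 1)) := by group
        _ = descProd s m q * s i * (s (i + 1) * s i) := by
          rw [← hbraid i (by omega)]; group
        _ = _ := by rw [this]; group
    · rw [descProd, mul_assoc, hfar (m - q) (i + 1) (by omega) (by omega), ← mul_assoc,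
        ih (by omega) h, mul_assoc]

theorem exists_mul_descProd (hsq : ∀ i < N, s i * s i = 1)
    (hbraid : ∀ i, i + 1 < N → s i * s (i + 1) * s i = s (i + 1) * s i * s (i + 1))
    (hfar : ∀ i j, i + 2 ≤ j → j < N → s i * s j = s j * s i) {m : ℕ} (hm : m < N) {g : Q}
    (hg : g ∈ Subgroup.closure (s '' Set.Iio (m + 1))) :
    ∃ h ∈ Subgroup.closure (s '' Set.Iio m), ∃ q ≤ m + 1, g = h * descProd s m q := by
  have step : ∀ h ∈ Subgroup.closure (s '' Set.Iio m), ∀ q ≤ m + 1, ∀ i < m + 1,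
      ∃ h' ∈ Subgroup.closure (s '' Set.Iio m), ∃ q' ≤ m + 1,
        h * descProd s m q * s i = h' * descProd s m q' := by
    intro h hh q hq i hi
    have hmem : ∀ j < m, s j ∈ Subgroup.closure (s '' Set.Iio m) := fun j hj =>
      Subgroup.subset_closure ⟨j, hj, rfl⟩
    obtain h1 | h1 | h1 | h1 : i + q = m ∨ i + q = m + 1 ∨ i + q < m ∨ m + 1 < i + q := by omega
    · exact ⟨h, hh, q + 1, by omega, by rw [descProd, mul_assoc, show m - q = i by omega]⟩
    · obtain ⟨q, rfl⟩ | rfl : (∃ q', q = q' + 1) ∨ q = 0 := by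
        rcases q with _ | q
        · exact Or.inr rfl
        · exact Or.inl ⟨q, rfl⟩
      · refine ⟨h, hh, q, by omega, ?_⟩
        rw [descProd, show m - q = i by omega, mul_assoc, mul_assoc, hsq i (by omega), mul_one]
      · omega
    · refine ⟨h * s i, mul_mem hh (hmem i (by omega)), q, hq, ?_⟩
      rw [mul_assoc, descProd_mul_of_lt hfar hm h1, mul_assoc]
    · obtain ⟨i, rfl⟩ : ∃ i', i = i' + 1 := ⟨i - 1, by omega⟩
      refine ⟨h * s i, mul_mem hh (hmem i (by omega)), q, hq, ?_⟩
      rw [mul_assoc, descProd_mul_of_gt hbraid hfar hm hq (by omega) (by omega), mul_assoc]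
  induction hg using Subgroup.closure_induction_right with
  | one => exact ⟨1, one_mem _, 0, by omega, by simp [descProd]⟩
  | mul_right x _ y hy ih =>
    obtain ⟨h, hh, q, hq, rfl⟩ := ih
    obtain ⟨i, hi, rfl⟩ := hy
    exact step h hh q hq i hi
  | mul_inv_cancel x _ y hy ih =>
    obtain ⟨h, hh, q, hq, rfl⟩ := ih
    obtain ⟨i, hi, rfl⟩ := hy
    have hi' : i < m + 1 := hi
    rw [inv_eq_of_mul_eq_one_left (hsq i (by omega))]
    exact step h hh q hq i hi

/-- The Coxeter relations of type `A` present the symmetric group: a homomorphism to a symmetric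
group mapping the generators to adjacent transpositions is injective on the subgroup which they
generate. -/
theorem eq_one_of_coxeter_relations {α : Type*} [DecidableEq α] (hsq : ∀ i < N, s i * s i = 1)
    (hbraid : ∀ i, i + 1 < N → s i * s (i + 1) * s i = s (i + 1) * s i * s (i + 1))
    (hfar : ∀ i j, i + 2 ≤ j → j < N → s i * s j = s j * s i)
    (π : Q →* Equiv.Perm α) (e : ℕ → α) (he : Set.InjOn e (Set.Iic N))
    (hπ : ∀ i < N, π (s i) = Equiv.swap (e i) (e (i + 1))) {m : ℕ} (hm : m ≤ N) {g : Q}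
    (hg : g ∈ Subgroup.closure (s '' Set.Iio m)) (hπg : π g = 1) : g = 1 := by
  induction m generalizing g with
  | zero => simpa using hg
  | succ m ih =>
    obtain ⟨h, hh, q, hq, rfl⟩ := exists_mul_descProd hsq hbraid hfar hm hg
    have hfix : π h (e (m + 1)) = e (m + 1) := by
      have : Subgroup.closure (s '' Set.Iio m) ≤
          (MulAction.stabilizer (Equiv.Perm α) (e (m + 1))).comap π := by
        rw [Subgroup.closure_le]
        rintro _ ⟨i, hi, rfl⟩
        have hi : i < m := hi
        simp only [SetLike.mem_coe, Subgroup.mem_comap, MulAction.mem_stabilizer_iff,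
          Equiv.Perm.smul_def]
        rw [hπ i (by omega), Equiv.swap_apply_of_ne_of_ne]
        · exact fun h => by
            have := he (Set.mem_Iic.2 (by omega)) (Set.mem_Iic.2 (by omega)) h; omega
        · exact fun h => by
            have := he (Set.mem_Iic.2 (by omega)) (Set.mem_Iic.2 (by omega)) h; omega
      exact this hh
    have hv : ∀ q ≤ m + 1, π (descProd s m q) (e (m + 1 - q)) = e (m + 1) := by
      intro q
      induction q with
      | zero => simp [descProd]
      | succ q ihq =>
        intro hq
        rw [descProd, map_mul, Equiv.Perm.mul_apply, hπ _ (by omega),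
          show m + 1 - (q + 1) = m - q by omega, Equiv.swap_apply_left,
          show m - q + 1 = m + 1 - q by omega, ihq (by omega)]
    have := congrArg (fun σ => σ (e (m + 1 - q))) hπg
    simp only [map_mul, Equiv.Perm.mul_apply, hv q hq, hfix, Equiv.Perm.one_apply] at this
    have := he (Set.mem_Iic.2 (by omega)) (Set.mem_Iic.2 (by omega)) this
    obtain rfl : q = 0 := by omega
    simp only [descProd, mul_one] at hπg ⊢
    exact ih (by omega) hh hπg

end CoxeterTypeA

namespace Schur

variable {n : ℕ}

/-- The generator `t_{i+1}`, indexed by a natural number (with value `1` out of range). -/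
def gen (n i : ℕ) : Cover n := if h : i < n - 1 then t n ⟨i, h⟩ else 1

theorem gen_eq {i : ℕ} (h : i < n - 1) : gen n i = t n ⟨i, h⟩ := dif_pos h

theorem z_mul_z : z n * z n = 1 := by
  rw [← sq]
  exact PresentedGroup.one_of_mem (Or.inl rfl)

theorem gen_mul_gen {i : ℕ} (h : i < n - 1) : gen n i * gen n i = z n := by
  rw [gen_eq h, ← mul_inv_eq_one, ← sq]
  exact PresentedGroup.one_of_mem (rels := rels n) (x := tf n ⟨i, h⟩ ^ 2 * (zf n)⁻¹)
    (Or.inr (Or.inl ⟨_, rfl⟩))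

theorem z_comm (x : Cover n) : z n * x = x * z n := by
  have := PresentedGroup.generated_by (rels n) (Subgroup.centralizer {z n}) (fun j => ?_) x
  · exact (Subgroup.mem_centralizer_singleton_iff.1 this).symm
  · rw [Subgroup.mem_centralizer_singleton_iff]
    obtain _ | i := j
    · rfl
    · change t n i * z n = z n * t n i
      rw [← gen_eq i.2, ← gen_mul_gen i.2, mul_assoc]

theorem gen_inv {i : ℕ} (h : i < n - 1) : (gen n i)⁻¹ = z n * gen n i := by
  rw [inv_eq_iff_mul_eq_one, ← mul_assoc, ← z_comm, mul_assoc, gen_mul_gen h, z_mul_z]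

theorem gen_mul_z_mul (i : ℕ) (x : Cover n) : gen n i * (z n * x) = z n * (gen n i * x) := by
  rw [← mul_assoc, ← z_comm, mul_assoc]

theorem z_mul_z_mul (x : Cover n) : z n * (z n * x) = x := by rw [← mul_assoc, z_mul_z, one_mul]

theorem gen_braid {i : ℕ} (h : i + 1 < n - 1) :
    gen n i * gen n (i + 1) * gen n i = gen n (i + 1) * gen n i * gen n (i + 1) := by
  have hi : i < n - 1 := by omega
  have h3 : (gen n i * gen n (i + 1)) ^ 3 = z n := by
    rw [gen_eq hi, gen_eq h, ← mul_inv_eq_one]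
    exact PresentedGroup.one_of_mem (rels := rels n)
      (x := (tf n ⟨i, hi⟩ * tf n ⟨i + 1, h⟩) ^ 3 * (zf n)⁻¹)
      (Or.inr (Or.inr (Or.inl ⟨_, _, rfl, rfl⟩)))
  calc gen n i * gen n (i + 1) * gen n i
      = (gen n i * gen n (i + 1)) ^ 3 * (gen n (i + 1))⁻¹ * (gen n i)⁻¹ * (gen n (i + 1))⁻¹ := by
        simp [pow_succ, mul_assoc]
    _ = z n * (z n * (z n * (z n * (gen n (i + 1) * gen n i * gen n (i + 1))))) := by
        rw [h3, gen_inv h, gen_inv hi]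
        simp only [mul_assoc, gen_mul_z_mul]
    _ = _ := by rw [z_mul_z_mul, z_mul_z_mul]

theorem gen_far {i j : ℕ} (hij : i + 2 ≤ j) (h : j < n - 1) :
    gen n i * gen n j = z n * (gen n j * gen n i) := by
  have hi : i < n - 1 := by omega
  have h3 : (gen n i * gen n j) ^ 2 = z n := by
    rw [gen_eq hi, gen_eq h, ← mul_inv_eq_one]
    exact PresentedGroup.one_of_mem (rels := rels n)
      (x := (tf n ⟨i, hi⟩ * tf n ⟨j, h⟩) ^ 2 * (zf n)⁻¹)
      (Or.inr (Or.inr (Or.inr ⟨_, _, Or.inl hij, rfl⟩)))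
  calc gen n i * gen n j = (gen n i * gen n j) ^ 2 * (gen n j)⁻¹ * (gen n i)⁻¹ := by
        simp [pow_succ, mul_assoc]
    _ = z n * (z n * (z n * (gen n j * gen n i))) := by
        rw [h3, gen_inv h, gen_inv hi]
        simp only [mul_assoc, gen_mul_z_mul]
    _ = _ := by rw [z_mul_z_mul]

theorem cover_induction {C : Cover n → Prop} (hz : C (z n)) (hg : ∀ i < n - 1, C (gen n i))
    (h1 : C 1) (hmul : ∀ x y, C x → C y → C (x * y)) (x : Cover n) : C x := by
  let H : Submonoid (Cover n) := ⟨⟨{x | C x}, fun hx hy => hmul _ _ hx hy⟩, h1⟩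
  have hzinv : (z n)⁻¹ = z n := inv_eq_of_mul_eq_one_left z_mul_z
  have hmem : ∀ y ∈ Set.range (PresentedGroup.of (rels := rels n)), y ∈ H ∧ y⁻¹ ∈ H := by
    rintro _ ⟨_ | i, rfl⟩
    · refine ⟨hz, ?_⟩
      change C (z n)⁻¹
      rwa [hzinv]
    · have h := hg i i.2
      have h' := gen_inv i.2
      rw [gen_eq i.2] at h h'
      refine ⟨h, ?_⟩
      change C (t n i)⁻¹
      rw [h']
      exact hmul _ _ hz h
  have hx : x ∈ Subgroup.closure (Set.range (PresentedGroup.of (rels := rels n))) := by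
    rw [PresentedGroup.closure_range_of]; trivial
  induction hx using Subgroup.closure_induction_right with
  | one => exact h1
  | mul_right x _ y hy ih => exact hmul _ _ ih (hmem y hy).1
  | mul_inv_cancel x _ y hy ih => exact hmul _ _ ih (hmem y hy).2

section Projection

variable {π : Cover n →* Equiv.Perm (Fin n)}

theorem proj_gen (hπt : ∀ i : Fin (n - 1), π (t n i) = adj n i) {i : ℕ} (h : i < n - 1) :
    π (gen n i) = Equiv.swap ⟨i, by omega⟩ ⟨i + 1, by omega⟩ := by
  rw [gen_eq h, hπt, adj]

theorem proj_surjective (hπt : ∀ i : Fin (n - 1), π (t n i) = adj n i) :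
    Function.Surjective π := by
  obtain _ | n := n
  · exact fun σ => ⟨1, Subsingleton.elim _ _⟩
  rw [← MonoidHom.mrange_eq_top, eq_top_iff, ← Equiv.Perm.mclosure_swap_castSucc_succ,
    Submonoid.closure_le]
  rintro _ ⟨i, rfl⟩
  exact ⟨t (n + 1) i, hπt i⟩

theorem eq_one_or_eq_z_of_proj_eq_one (hn : 0 < n)
    (hπt : ∀ i : Fin (n - 1), π (t n i) = adj n i) (hπz : π (z n) = 1) {g : Cover n}
    (hg : π g = 1) : g = 1 ∨ g = z n := by
  have hnormal : (Subgroup.zpowers (z n)).Normal := ⟨fun x hx y => by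
    obtain ⟨m, rfl⟩ := hx
    have : Commute (z n) y := z_comm y
    exact ⟨m, by simp [← (this.zpow_left m).eq]⟩⟩
  have hle : Subgroup.zpowers (z n) ≤ π.ker := by
    rw [Subgroup.zpowers_le]; exact hπz
  set φ := QuotientGroup.mk' (Subgroup.zpowers (z n))
  have hφz : φ (z n) = 1 := (QuotientGroup.eq_one_iff _).2 (Subgroup.mem_zpowers _)
  have hφg : ∀ g, φ g ∈ Subgroup.closure ((fun i => φ (gen n i)) '' Set.Iio (n - 1)) := fun g => by
    induction g using cover_induction with
    | hz => rw [hφz]; exact one_mem _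
    | hg i hi => exact Subgroup.subset_closure ⟨i, hi, rfl⟩
    | h1 => exact one_mem _
    | hmul x y hx hy => exact map_mul φ x y ▸ mul_mem hx hy
  have := eq_one_of_coxeter_relations (s := fun i => φ (gen n i)) (N := n - 1)
    (fun i hi => by simp only [← map_mul, gen_mul_gen hi, hφz])
    (fun i hi => by simp only [← map_mul, gen_braid hi])
    (fun i j hij hj => by simp only [← map_mul, gen_far hij hj]; rw [map_mul, hφz, one_mul])
    (QuotientGroup.lift _ π hle) (fun i => if h : i < n then ⟨i, h⟩ else ⟨0, hn⟩)
    (fun i hi j hj h => by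
      rw [Set.mem_Iic] at hi hj
      beta_reduce at h
      rw [dif_pos (by omega), dif_pos (by omega)] at h
      exact congrArg Fin.val h)
    (fun i hi => by
      rw [dif_pos (by omega), dif_pos (by omega)]
      exact proj_gen hπt hi) le_rfl (hφg g) hg
  obtain ⟨m, hm⟩ := (QuotientGroup.eq_one_iff _).1 this
  beta_reduce at hm
  obtain ⟨l, rfl | rfl⟩ := m.even_or_odd'
  · left; rw [← hm, zpow_mul]; simp [sq, z_mul_z]
  · right; rw [← hm, zpow_add, zpow_mul]; simp [sq, z_mul_z]

end Projection

end Schur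

section FourSums

theorem eq_of_four_sums {M : Type*} [AddCommGroup M] [Module ℂ M] (G : ℕ → ℕ → ℕ → M) (w : M)
    (K : ∀ a b c d, a < b ∧ b < c ∧ c < d ∧ d < 7 →
      G a b c + G a b d + G b c d + G a c d = (4 : ℂ) • w) : G 0 1 2 = w := by
  linear_combination (norm := module) (1 / 4 : ℂ) • (
      K 0 1 2 3 (by decide) + K 0 1 2 4 (by decide) + K 0 1 2 5 (by decide)
        + K 0 1 2 6 (by decide)) +
    (-1 / 12 : ℂ) • (
      K 0 1 3 4 (by decide) + K 0 1 3 5 (by decide) + K 0 1 3 6 (by decide)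
        + K 0 1 4 5 (by decide) + K 0 1 4 6 (by decide) + K 0 1 5 6 (by decide)
        + K 0 2 3 4 (by decide) + K 0 2 3 5 (by decide) + K 0 2 3 6 (by decide)
        + K 0 2 4 5 (by decide) + K 0 2 4 6 (by decide) + K 0 2 5 6 (by decide)
        + K 1 2 3 4 (by decide) + K 1 2 3 5 (by decide) + K 1 2 3 6 (by decide)
        + K 1 2 4 5 (by decide) + K 1 2 4 6 (by decide) + K 1 2 5 6 (by decide)) +
    (1 / 12 : ℂ) • (
      K 0 3 4 5 (by decide) + K 0 3 4 6 (by decide) + K 0 3 5 6 (by decide)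
        + K 0 4 5 6 (by decide) + K 1 3 4 5 (by decide) + K 1 3 4 6 (by decide)
        + K 1 3 5 6 (by decide) + K 1 4 5 6 (by decide) + K 2 3 4 5 (by decide)
        + K 2 3 4 6 (by decide) + K 2 3 5 6 (by decide) + K 2 4 5 6 (by decide)) +
    (-1 / 4 : ℂ) • (
      K 3 4 5 6 (by decide))

end FourSums

namespace Schur

open Module

variable {n : ℕ} {V : Type*} [AddCommGroup V] [Module ℂ V]

theorem spinSystem_of_spin {ρ : Cover n →* End ℂ V} (hspin : ρ (z n) = -1) {N : ℕ}
    (hN : N ≤ n - 1) (E : ℕ → End ℂ V) : SpinSystem N 0 (fun i => ρ (gen n i)) E where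
  T_sq i hi := by rw [← map_mul, gen_mul_gen (by omega), hspin]
  braid i hi := by simp only [← map_mul, gen_braid (show i + 1 < n - 1 by omega)]
  far i j hij hj := by
    rw [← map_mul, gen_far hij (by omega), map_mul, hspin, map_mul, neg_one_mul]
  E_sq j hj := by omega
  E_anti i j _ hj := by omega
  TE_anti i j _ hj := by omega

theorem z_ne_one_of_spin [Nontrivial V] {ρ : Cover n →* End ℂ V} (hspin : ρ (z n) = -1) :
    z n ≠ 1 := by
  intro h
  rw [h, map_one] at hspin
  obtain ⟨x, hx⟩ := exists_ne (0 : V)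
  exact hx (eq_zero_of_eq_neg_self (LinearMap.congr_fun hspin x))

section TripleOperator

variable (π : Cover n →* Equiv.Perm (Fin n)) (ρ : Cover n →* End ℂ V)

open Classical in
/-- `1 + ρ ℓ + ρ ℓ²` for a lift `ℓ` of order three of a permutation `σ`. -/
noncomputable def tripleOp (σ : Equiv.Perm (Fin n)) : End ℂ V :=
  if h : ∃ l, π l = σ ∧ l ^ 3 = 1 then 1 + ρ h.choose + ρ h.choose * ρ h.choose else 0

variable {π ρ}

theorem eq_or_eq_z_mul (hn : 0 < n) (hπt : ∀ i : Fin (n - 1), π (t n i) = adj n i)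
    (hπz : π (z n) = 1) {x y : Cover n} (h : π x = π y) : x = y ∨ x = z n * y := by
  have : π (x * y⁻¹) = 1 := by rw [map_mul, map_inv, h, mul_inv_cancel]
  obtain h | h := eq_one_or_eq_z_of_proj_eq_one hn hπt hπz this
  · exact Or.inl (mul_inv_eq_one.1 h)
  · exact Or.inr (mul_inv_eq_iff_eq_mul.1 h)

theorem z_mul_pow (x : Cover n) (m : ℕ) : (z n * x) ^ m = z n ^ m * x ^ m :=
  Commute.mul_pow (z_comm x) m

theorem tripleOp_eq (hn : 0 < n) (hπt : ∀ i : Fin (n - 1), π (t n i) = adj n i)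
    (hπz : π (z n) = 1) (hz : z n ≠ 1) {l : Cover n} (hl : l ^ 3 = 1) :
    tripleOp π ρ (π l) = 1 + ρ l + ρ l * ρ l := by
  have h : ∃ l', π l' = π l ∧ l' ^ 3 = 1 := ⟨l, rfl, hl⟩
  rw [tripleOp, dif_pos h]
  obtain h' | h' := eq_or_eq_z_mul hn hπt hπz h.choose_spec.1
  · rw [h']
  · have := h.choose_spec.2
    rw [h', z_mul_pow, hl, mul_one, pow_succ, sq, z_mul_z, one_mul] at this
    exact absurd this hz

theorem tripleOp_conj (hn : 0 < n) (hπt : ∀ i : Fin (n - 1), π (t n i) = adj n i)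
    (hπz : π (z n) = 1) (hz : z n ≠ 1) {l : Cover n} (hl : l ^ 3 = 1) (h : Cover n) :
    tripleOp π ρ (π h * π l * (π h)⁻¹) = ρ h * tripleOp π ρ (π l) * ρ h⁻¹ := by
  have hh : ρ h * ρ h⁻¹ = 1 := by rw [← map_mul, mul_inv_cancel, map_one]
  have hh' : ∀ x, ρ h⁻¹ * (ρ h * x) = x := fun x => by
    rw [← mul_assoc, ← map_mul, inv_mul_cancel, map_one, one_mul]
  rw [← map_mul, ← map_inv, ← map_mul, tripleOp_eq hn hπt hπz hz hl,
    tripleOp_eq hn hπt hπz hz (by rw [conj_pow, hl, mul_one, mul_inv_cancel])]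
  simp only [map_mul, mul_add, add_mul, mul_one, hh, mul_assoc, hh']

end TripleOperator

theorem swap_mul_swap_conj {α : Type*} [DecidableEq α] (σ : Equiv.Perm α) (a b c : α) :
    σ * (Equiv.swap a b * Equiv.swap b c) * σ⁻¹ =
      Equiv.swap (σ a) (σ b) * Equiv.swap (σ b) (σ c) := by
  rw [Equiv.swap_apply_apply, Equiv.swap_apply_apply]
  group

theorem exists_perm_four {α : Type*} [DecidableEq α] (x y : Fin 4 → α)
    (hx : Function.Injective x) (hy : Function.Injective y) : ∃ σ : Equiv.Perm α, ∀ i,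
      σ (x i) = y i := by
  have := Equiv.Perm.isMultiplyPretransitive α 4
  obtain ⟨σ, hσ⟩ := this.exists_smul_eq ⟨x, hx⟩ ⟨y, hy⟩
  exact ⟨σ, fun i => DFunLike.congr_fun hσ i⟩

/-- A spin representation of `S̃_n` of minimal dimension satisfies the relations of a basic one. -/
theorem gen_anticommutator_of_finrank [FiniteDimensional ℂ V] [Nontrivial V] (hn : 8 < n)
    {π : Cover n →* Equiv.Perm (Fin n)} (hπt : ∀ i : Fin (n - 1), π (t n i) = adj n i)
    (hπz : π (z n) = 1) {ρ : Cover n →* End ℂ V} (hspin : ρ (z n) = -1)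
    (hdim : finrank ℂ V = 2 ^ ((n - 1) / 2)) {i : ℕ} (hi : i + 1 < n - 1) :
    ρ (gen n i) * ρ (gen n (i + 1)) + ρ (gen n (i + 1)) * ρ (gen n i) = 1 := by
  have hz := z_ne_one_of_spin hspin
  have hS := spinSystem_of_spin hspin (N := n - 1) le_rfl (fun _ => 1)
  suffices h0 : tripleFix (ρ (gen n 0)) (ρ (gen n 1)) = 0 by
    have := hS.tripleFix_eq_zero h0 i hi
    rw [tripleFix, sub_sub, sub_eq_zero] at this
    exact this.symm
  by_contra h0
  have hsum := (spinSystem_of_spin hspin (N := 2 * ((n - 1) / 2)) (by omega)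
    (fun _ => 1)).tripleFixSum_eq (by omega) (even_two_mul _)
      (by rw [Nat.mul_div_cancel_left _ two_pos, hdim]) h0
  set a := ρ (gen n 0) with ha
  set b := ρ (gen n 1) with hb
  set c := ρ (gen n 2) with hc
  have haa : a * a = -1 := hS.T_sq 0 (by omega)
  have hbb : b * b = -1 := hS.T_sq 1 (by omega)
  have hcc : c * c = -1 := hS.T_sq 2 (by omega)
  have hab : a * b * a = b * a * b := hS.braid 0 (by omega)
  have hbc : b * c * b = c * b * c := hS.braid 1 (by omega)
  have hinv : ∀ i < n - 1, ρ (gen n i)⁻¹ = -ρ (gen n i) := fun i hi => by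
    rw [gen_inv hi, map_mul, hspin, neg_one_mul]
  set pt : ℕ → Fin n := fun i => if h : i < n then ⟨i, h⟩ else ⟨0, by omega⟩ with hpt
  have hptinj : ∀ i j, i < n → j < n → pt i = pt j → i = j := fun i j hi hj h => by
    simpa [hpt, hi, hj] using h
  have hgen : ∀ i < n - 1, π (gen n i) = Equiv.swap (pt i) (pt (i + 1)) := fun i hi => by
    rw [proj_gen hπt hi]
    simp only [hpt]
    rw [dif_pos (by omega), dif_pos (by omega)]
  set F : Fin n → Fin n → Fin n → End ℂ V := fun x y w =>
    tripleOp π ρ (Equiv.swap x y * Equiv.swap y w) with hF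
  have hlift : ∀ i, i + 1 < n - 1 → (z n * (gen n i * gen n (i + 1))) ^ 3 = 1 ∧
      π (z n * (gen n i * gen n (i + 1))) =
        Equiv.swap (pt i) (pt (i + 1)) * Equiv.swap (pt (i + 1)) (pt (i + 2)) := by
    intro i hi
    refine ⟨?_, ?_⟩
    · have h3 : (gen n i * gen n (i + 1)) ^ 3 = z n := by
        calc _ = gen n i * gen n (i + 1) * gen n i * (gen n (i + 1) * gen n i * gen n (i + 1)) := by
              simp [pow_succ, mul_assoc]
          _ = gen n i * (gen n (i + 1) * (gen n i * gen n i) * gen n (i + 1)) * gen n i := by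
              rw [← gen_braid hi]; simp [mul_assoc]
          _ = _ := by
              rw [gen_mul_gen (by omega), ← z_comm, mul_assoc (z n), gen_mul_gen (by omega),
                z_mul_z, mul_one, gen_mul_gen (by omega)]
      rw [z_mul_pow, h3, pow_succ, sq, z_mul_z, one_mul, z_mul_z]
    · rw [map_mul, hπz, one_mul, map_mul, hgen i (by omega), hgen (i + 1) hi]
  have hn0 : 0 < n := by omega
  have hFlift : ∀ i (hi : i + 1 < n - 1), F (pt i) (pt (i + 1)) (pt (i + 2)) =
      tripleFix (ρ (gen n i)) (ρ (gen n (i + 1))) := by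
    intro i hi
    have hbr := hS.braid i hi
    have hsq := hS.T_sq (i + 1) hi
    rw [hF]
    dsimp only
    rw [← (hlift i hi).2, tripleOp_eq hn0 hπt hπz hz (hlift i hi).1, map_mul, hspin, map_mul,
      neg_one_mul, neg_mul_neg, ← mul_assoc, hbr, mul_assoc _ _ (ρ (gen n (i + 1))), hsq]
    simp [tripleFix, sub_eq_add_neg]
  set Q : Fin n → Fin n → Fin n → Prop := fun x y w =>
    ∃ l : Cover n, l ^ 3 = 1 ∧ π l = Equiv.swap x y * Equiv.swap y w with hQ
  have hconj : ∀ x y w, Q x y w → ∀ h : Cover n, F (π h x) (π h y) (π h w) =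
      ρ h * F x y w * ρ h⁻¹ := by
    rintro x y w ⟨l, hl, hl'⟩ h
    simp only [hF]
    rw [← swap_mul_swap_conj, ← hl', tripleOp_conj hn0 hπt hπz hz hl]
  have hQconj : ∀ x y w, Q x y w → ∀ h : Cover n, Q (π h x) (π h y) (π h w) := by
    rintro x y w ⟨l, hl, hl'⟩ h
    refine ⟨h * l * h⁻¹, by rw [conj_pow, hl, mul_one, mul_inv_cancel], ?_⟩
    rw [← swap_mul_swap_conj, ← hl', map_mul, map_mul, map_inv]
  have h01 : F (pt 0) (pt 1) (pt 2) = tripleFix a b := hFlift 0 (by omega)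
  have h12 : F (pt 1) (pt 2) (pt 3) = tripleFix b c := hFlift 1 (by omega)
  have hQ01 : Q (pt 0) (pt 1) (pt 2) := ⟨_, hlift 0 (by omega)⟩
  have hQ12 : Q (pt 1) (pt 2) (pt 3) := ⟨_, hlift 1 (by omega)⟩
  have ne : ∀ i j, i < n → j < n → i ≠ j → pt i ≠ pt j := fun i j hi hj hij h =>
    hij (hptinj i j hi hj h)
  have g2 : π (gen n 2) (pt 0) = pt 0 ∧ π (gen n 2) (pt 1) = pt 1 ∧
      π (gen n 2) (pt 2) = pt 3 := by
    rw [hgen 2 (by omega)]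
    refine ⟨Equiv.swap_apply_of_ne_of_ne ?_ ?_, Equiv.swap_apply_of_ne_of_ne ?_ ?_,
      Equiv.swap_apply_left _ _⟩ <;> exact ne _ _ (by omega) (by omega) (by omega)
  have g0 : π (gen n 0) (pt 1) = pt 0 ∧ π (gen n 0) (pt 2) = pt 2 ∧
      π (gen n 0) (pt 3) = pt 3 := by
    rw [hgen 0 (by omega)]
    refine ⟨Equiv.swap_apply_right _ _, Equiv.swap_apply_of_ne_of_ne ?_ ?_,
      Equiv.swap_apply_of_ne_of_ne ?_ ?_⟩ <;> exact ne _ _ (by omega) (by omega) (by omega)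
  have hQ013 := hQconj _ _ _ hQ01 (gen n 2)
  have h013 := hconj _ _ _ hQ01 (gen n 2)
  rw [g2.1, g2.2.1, g2.2.2] at hQ013 h013
  have hQ023 := hQconj _ _ _ hQ12 (gen n 0)
  have h023 := hconj _ _ _ hQ12 (gen n 0)
  rw [g0.1, g0.2.1, g0.2.2] at hQ023 h023
  rw [hinv 2 (by omega), h01] at h013
  rw [hinv 0 (by omega), h12] at h023
  have hsum' : F (pt 0) (pt 1) (pt 2) + F (pt 0) (pt 1) (pt 3) + F (pt 1) (pt 2) (pt 3) +
      F (pt 0) (pt 2) (pt 3) = (6 : ℂ) • 1 := by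
    rw [h01, h12, h013, h023, ← hsum, tripleFixSum]
    noncomm_ring
  have hfour : ∀ i j k l, i < j ∧ j < k ∧ k < l ∧ l < 7 →
      F (pt i) (pt j) (pt k) + F (pt i) (pt j) (pt l) + F (pt j) (pt k) (pt l) +
        F (pt i) (pt k) (pt l) = (4 : ℂ) • ((3 / 2 : ℂ) • 1) := by
    rintro i j k l ⟨hij, hjk, hkl, hl⟩
    have hx : Function.Injective fun i : Fin 4 => pt i := fun i j h =>
      Fin.ext (hptinj _ _ (by omega) (by omega) h)
    have hy : Function.Injective fun m : Fin 4 => pt (![i, j, k, l] m) := by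
      intro m m' h
      have := hptinj _ _ (by fin_cases m <;> simp <;> omega) (by fin_cases m' <;> simp <;> omega) h
      fin_cases m <;> fin_cases m' <;> simp at this ⊢ <;> omega
    obtain ⟨σ, hσ⟩ := exists_perm_four _ _ hx hy
    obtain ⟨h, rfl⟩ := proj_surjective hπt σ
    have e0 : π h (pt 0) = pt i := hσ 0
    have e1 : π h (pt 1) = pt j := hσ 1
    have e2 : π h (pt 2) = pt k := hσ 2
    have e3 : π h (pt 3) = pt l := hσ 3
    rw [← e0, ← e1, ← e2, ← e3, hconj _ _ _ hQ01, hconj _ _ _ hQ013, hconj _ _ _ hQ12,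
      hconj _ _ _ hQ023, ← add_mul, ← add_mul, ← add_mul, ← mul_add, ← mul_add, ← mul_add, hsum',
      mul_smul_comm, mul_one, smul_mul_assoc, ← map_mul, mul_inv_cancel, map_one, smul_smul]
    norm_num
  have h32 := eq_of_four_sums (fun i j k => F (pt i) (pt j) (pt k)) _ hfour
  have hff := tripleFix_mul_self haa hbb hab
  rw [← h01, h32, ← Nat.cast_smul_eq_nsmul ℂ, smul_mul_smul_comm, one_mul, smul_smul] at hff
  obtain ⟨x, hx⟩ := exists_ne (0 : V)
  have := smul_left_injective ℂ hx (LinearMap.congr_fun hff x)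
  norm_num at this

end Schur

section BasicClifford

open Module Finset

variable {V : Type*} [AddCommGroup V] [Module ℂ V]

theorem anticommutator_sum {N : ℕ} {T : ℕ → End ℂ V} (hsq : ∀ i < N, T i * T i = -1)
    (hadj : ∀ i, i + 1 < N → T i * T (i + 1) + T (i + 1) * T i = 1)
    (hfar : ∀ i j, i + 2 ≤ j → j < N → T i * T j = -(T j * T i)) {l j : ℕ} (hl : l < N)
    (hj : j ≤ N) : T l * (∑ m ∈ range j, T m) + (∑ m ∈ range j, T m) * T l =
      ((if l = j then 1 else 0) - (if l = 0 then 1 else 0) - (if l + 1 = j then 1 else 0) : ℂ) •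
        1 := by
  induction j with
  | zero => simp
  | succ j ih =>
    rw [sum_range_succ, mul_add, add_mul, add_add_add_comm, ih (by omega)]
    have key : T l * T j + T j * T l = ((if l + 1 = j then 1 else 0) +
        (if l = j + 1 then 1 else 0) - 2 * (if l = j then 1 else 0) : ℂ) • 1 := by
      obtain h | h | h | h | h : l + 2 ≤ j ∨ l + 1 = j ∨ l = j ∨ l = j + 1 ∨ j + 2 ≤ l := by omega
      · rw [hfar l j h (by omega), if_neg (by omega), if_neg (by omega), if_neg (by omega)]
        simp
      · subst h
        rw [hadj l (by omega), if_pos rfl, if_neg (by omega), if_neg (by omega)]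
        simp
      · subst h
        rw [hsq l hl, if_neg (by omega), if_neg (by omega), if_pos rfl]
        module
      · subst h
        rw [add_comm, hadj j (by omega), if_neg (by omega), if_pos rfl, if_neg (by omega)]
        simp
      · rw [hfar j l h hl, if_neg (by omega), if_neg (by omega), if_neg (by omega)]
        simp
    rw [key, ← add_smul]
    congr 1
    simp only [add_left_inj]
    ring

theorem anticommutator_sum_sum {N : ℕ} {T : ℕ → End ℂ V} (hsq : ∀ i < N, T i * T i = -1)
    (hadj : ∀ i, i + 1 < N → T i * T (i + 1) + T (i + 1) * T i = 1)
    (hfar : ∀ i j, i + 2 ≤ j → j < N → T i * T j = -(T j * T i)) {i j : ℕ} (hi : i ≤ N)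
    (hj : j ≤ N) : (∑ l ∈ range i, T l) * (∑ m ∈ range j, T m) +
      (∑ m ∈ range j, T m) * (∑ l ∈ range i, T l) =
      ((if i = 0 then 1 else 0) + (if j = 0 then 1 else 0) - (if i = j then 1 else 0) - 1 : ℂ) •
        1 := by
  induction i with
  | zero => simp [eq_comm]
  | succ i ih =>
    rw [sum_range_succ, mul_add, add_mul, add_add_add_comm, ih (by omega),
      anticommutator_sum hsq hadj hfar (by omega) hj, ← add_smul]
    congr 1
    rw [if_neg i.succ_ne_zero]
    ring

end BasicClifford

namespace Schur

open Module Finset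

variable {n : ℕ} {V : Type*} [AddCommGroup V] [Module ℂ V] {ρ : Cover n →* End ℂ V}

/-- The linear map from `ℂⁿ` to the endomorphisms of a basic spin representation whose restriction
to vectors of coordinate sum zero satisfies the Clifford relations. -/
noncomputable def cliff (ρ : Cover n →* End ℂ V) (v : Fin n → ℂ) : End ℂ V :=
  ∑ i, v i • ∑ l ∈ range i, ρ (gen n l)

theorem cliff_anticommutator (hspin : ρ (z n) = -1)
    (hadj : ∀ i, i + 1 < n - 1 →
      ρ (gen n i) * ρ (gen n (i + 1)) + ρ (gen n (i + 1)) * ρ (gen n i) = 1)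
    {v w : Fin n → ℂ} (hv : ∑ i, v i = 0) (hw : ∑ i, w i = 0) :
    cliff ρ v * cliff ρ w + cliff ρ w * cliff ρ v = (-∑ i, v i * w i) • 1 := by
  have hS := spinSystem_of_spin hspin (N := n - 1) le_rfl (fun _ => 1)
  obtain rfl | hn := n.eq_zero_or_pos
  · simp [cliff]
  have key : ∀ i j : Fin n, (∑ l ∈ range i, ρ (gen n l)) * (∑ m ∈ range j, ρ (gen n m)) +
      (∑ m ∈ range j, ρ (gen n m)) * (∑ l ∈ range i, ρ (gen n l)) =
      ((if i = ⟨0, hn⟩ then 1 else 0) + (if j = ⟨0, hn⟩ then 1 else 0) -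
        (if i = j then 1 else 0) - 1 : ℂ) • 1 := fun i j => by
    simpa only [Fin.ext_iff] using anticommutator_sum_sum hS.T_sq hadj hS.far
      (show (i : ℕ) ≤ n - 1 by omega) (show (j : ℕ) ≤ n - 1 by omega)
  calc _ = ∑ i, ∑ j, (v i * w j) • ((∑ l ∈ range i, ρ (gen n l)) * (∑ m ∈ range j, ρ (gen n m)) +
        (∑ m ∈ range j, ρ (gen n m)) * (∑ l ∈ range i, ρ (gen n l))) := by
        simp only [cliff, sum_mul_sum, smul_mul_smul_comm, smul_add, sum_add_distrib]
        congr 1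
        rw [sum_comm]
        simp only [mul_comm]
    _ = (∑ i, ∑ j, (v i * w j) * ((if i = ⟨0, hn⟩ then 1 else 0) +
          (if j = ⟨0, hn⟩ then 1 else 0) - (if i = j then 1 else 0) - 1 : ℂ)) • 1 := by
        simp only [key, smul_smul, sum_smul]
    _ = _ := by
        congr 1
        simp only [mul_sub, mul_add, sum_sub_distrib, sum_add_distrib, mul_one, mul_ite, mul_zero,
          sum_ite_eq, sum_ite_eq', mem_univ, if_true, ← mul_sum, ← sum_mul, hv, hw]
        simp [← mul_sum, hw]

theorem exists_gen_sum_equivariant {π : Cover n →* Equiv.Perm (Fin n)}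
    (hπt : ∀ i : Fin (n - 1), π (t n i) = adj n i) (hπz : π (z n) = 1) (hspin : ρ (z n) = -1)
    (hadj : ∀ i, i + 1 < n - 1 →
      ρ (gen n i) * ρ (gen n (i + 1)) + ρ (gen n (i + 1)) * ρ (gen n i) = 1) (g : Cover n) :
    ∃ d : End ℂ V, ∀ i : Fin n, ρ g * ∑ l ∈ range i, ρ (gen n l) =
      ((Equiv.Perm.sign (π g) : ℤ) : ℂ) • ((∑ l ∈ range (π g i), ρ (gen n l)) * ρ g) + d := by
  have hS := spinSystem_of_spin hspin (N := n - 1) le_rfl (fun _ => 1)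
  induction g using cover_induction with
  | hz => exact ⟨0, fun i => by simp [hπz, hspin]⟩
  | h1 => exact ⟨0, fun i => by simp⟩
  | hmul x y hx hy =>
    obtain ⟨d, hd⟩ := hx
    obtain ⟨d', hd'⟩ := hy
    refine ⟨((Equiv.Perm.sign (π y) : ℤ) : ℂ) • (d * ρ y) + ρ x * d', fun i => ?_⟩
    rw [map_mul, mul_assoc, hd', mul_add, mul_smul_comm, ← mul_assoc, hd, add_mul, smul_mul_assoc,
      smul_add, smul_smul, map_mul, map_mul, Equiv.Perm.mul_apply, mul_assoc, ← add_assoc]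
    congr 3
    push_cast
    ring
  | hg l hl =>
    refine ⟨(if l = 0 then -1 else 0 : ℂ) • 1, fun i => ?_⟩
    rw [proj_gen hπt hl, Equiv.Perm.sign_swap (by simp)]
    have h1 := anticommutator_sum hS.T_sq hadj hS.far hl (show (i : ℕ) ≤ n - 1 by omega)
    rw [← eq_sub_iff_add_eq] at h1
    have hsq := hS.T_sq l hl
    rw [h1]
    obtain h | h | ⟨h, h'⟩ : (i : ℕ) = l ∨ (i : ℕ) = l + 1 ∨ ((i : ℕ) ≠ l ∧ (i : ℕ) ≠ l + 1) := by
      tauto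
    · rw [show i = ⟨l, by omega⟩ from Fin.ext h, Equiv.swap_apply_left]
      simp only [sum_range_succ, add_mul, hsq, if_true, if_neg l.succ_ne_self]
      split_ifs <;> push_cast <;> module
    · rw [show i = ⟨l + 1, by omega⟩ from Fin.ext h, Equiv.swap_apply_right]
      simp only [sum_range_succ, add_mul, hsq, if_true, if_neg l.succ_ne_self.symm]
      split_ifs <;> push_cast <;> module
    · rw [Equiv.swap_apply_of_ne_of_ne (fun e => h (congrArg Fin.val e))
        (fun e => h' (congrArg Fin.val e)), if_neg (Ne.symm h), if_neg (Ne.symm h')]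
      split_ifs <;> simp [neg_add_eq_sub]

theorem cliff_equivariant {π : Cover n →* Equiv.Perm (Fin n)}
    (hπt : ∀ i : Fin (n - 1), π (t n i) = adj n i) (hπz : π (z n) = 1) (hspin : ρ (z n) = -1)
    (hadj : ∀ i, i + 1 < n - 1 →
      ρ (gen n i) * ρ (gen n (i + 1)) + ρ (gen n (i + 1)) * ρ (gen n i) = 1) (g : Cover n)
    {v w : Fin n → ℂ} (hv : ∑ i, v i = 0) (hw : ∀ i, w (π g i) = v i) :
    ρ g * cliff ρ v = ((Equiv.Perm.sign (π g) : ℤ) : ℂ) • (cliff ρ w * ρ g) := by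
  obtain ⟨d, hd⟩ := exists_gen_sum_equivariant hπt hπz hspin hadj g
  have : cliff ρ w = ∑ i, v i • ∑ l ∈ range (π g i), ρ (gen n l) := by
    rw [cliff, ← Equiv.sum_comp (π g)]
    simp only [hw]
  rw [this, cliff, Finset.mul_sum, Finset.sum_mul, Finset.smul_sum]
  have key : ∀ i : Fin n, ρ g * (v i • ∑ l ∈ range i, ρ (gen n l)) =
      ((Equiv.Perm.sign (π g) : ℤ) : ℂ) • ((v i • ∑ l ∈ range (π g i), ρ (gen n l)) * ρ g) +
        v i • d := fun i => by
    rw [mul_smul_comm, hd, smul_add, smul_mul_assoc, smul_comm]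
  rw [sum_congr rfl fun i _ => key i, sum_add_distrib, ← sum_smul, hv, zero_smul, add_zero]

end Schur

section Ladder

open Module

variable {V : Type*} [AddCommGroup V] [Module ℂ V]

theorem exists_lt_add_modEq {d : ℕ} (hd : 0 < d) (s i : ℕ) : ∃ j, j < d ∧ s + j ≡ i [MOD d] := by
  refine ⟨(i + d * s - s) % d, Nat.mod_lt _ hd, ?_⟩
  have : s ≤ d * s := Nat.le_mul_of_pos_left s hd
  calc s + (i + d * s - s) % d ≡ s + (i + d * s - s) [MOD d] :=
        (Nat.ModEq.refl s).add (Nat.mod_modEq _ _)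
    _ = i + d * s := by omega
    _ ≡ i [MOD d] := by simp [Nat.ModEq]

/-- Operators `A 1, …, A (d - 1)` satisfying Clifford relations, on which conjugation by `G` acts
by powers of `ζ`. -/
structure CliffordLadder (d : ℕ) (G : End ℂ V) (A : ℕ → End ℂ V) (ζ κ : ℂ) : Prop where
  ne_zero : κ ≠ 0
  conj : ∀ a, 0 < a → a < d → G * A a = ζ ^ a • (A a * G)
  anticomm : ∀ a b, 0 < a → a < d → 0 < b → b < d →
    A a * A b + A b * A a = (if a + b = d then κ else 0) • 1

namespace CliffordLadder

variable {d : ℕ} {G : End ℂ V} {A : ℕ → End ℂ V} {ζ κ : ℂ}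

theorem apply_eq (H : CliffordLadder d G A ζ κ) {a : ℕ} (ha : 0 < a) (ha' : a < d) {μ : ℂ} {u : V}
    (hu : G u = μ • u) : G (A a u) = (μ * ζ ^ a) • A a u := by
  have := LinearMap.congr_fun (H.conj a ha ha') u
  simp only [End.mul_apply, LinearMap.smul_apply, hu, map_smul, smul_smul] at this
  rw [this, mul_comm]

theorem anticomm_apply (H : CliffordLadder d G A ζ κ) {a b : ℕ} (ha : 0 < a) (ha' : a < d)
    (hb : 0 < b) (hb' : b < d) (u : V) :
    A a (A b u) + A b (A a u) = (if a + b = d then κ else 0) • u := by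
  exact LinearMap.congr_fun (H.anticomm a b ha ha' hb hb') u

theorem apply_apply_eq_zero (H : CliffordLadder d G A ζ κ) {a b : ℕ} (ha : 0 < a) (ha' : a < d)
    (hb : 0 < b) (hb' : b < d) (hab : a + b ≠ d) {u : V} (hu : A a u = 0) : A a (A b u) = 0 := by
  simpa [hu, hab] using H.anticomm_apply ha ha' hb hb' u

theorem apply_self_eq_zero (H : CliffordLadder d G A ζ κ) {a : ℕ} (ha : 0 < a) (ha' : a < d)
    (haa : a + a ≠ d) (u : V) : A a (A a u) = 0 := by
  have := H.anticomm_apply ha ha' ha ha' u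
  rw [if_neg haa, zero_smul, ← two_smul ℂ] at this
  simpa using this

theorem exists_lowest (H : CliffordLadder d G A ζ κ) {μ : ℂ} {u : V} (hu : u ≠ 0)
    (hGu : G u = μ • u) (m : ℕ) :
    ∃ (s : ℕ) (w : V), w ≠ 0 ∧ G w = (μ * ζ ^ s) • w ∧
      ∀ b, 0 < b → b ≤ m → 2 * b < d → A (d - b) w = 0 := by
  induction m with
  | zero => exact ⟨0, u, hu, by simpa using hGu, fun b h1 h2 => by omega⟩
  | succ m ih =>
    obtain ⟨s, w, hw, hGw, hlow⟩ := ih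
    by_cases hm : 2 * (m + 1) < d ∧ A (d - (m + 1)) w ≠ 0
    · refine ⟨s + (d - (m + 1)), A (d - (m + 1)) w, hm.2, ?_, fun b h1 h2 h3 => ?_⟩
      · rw [H.apply_eq (by omega) (by omega) hGw, pow_add, mul_assoc]
      · obtain rfl | h := h2.eq_or_lt
        · exact H.apply_self_eq_zero (by omega) (by omega) (by omega) w
        · exact H.apply_apply_eq_zero (by omega) (by omega) (by omega) (by omega) (by omega)
            (hlow b h1 (by omega) h3)
    · refine ⟨s, w, hw, hGw, fun b h1 h2 h3 => ?_⟩
      obtain rfl | h := h2.eq_or_lt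
      · by_contra h
        exact hm ⟨h3, h⟩
      · exact hlow b h1 (by omega) h3

theorem exists_raise (H : CliffordLadder d G A ζ κ) {μ : ℂ} {u : V} (hu : u ≠ 0)
    (hGu : G u = μ • u) (hlow : ∀ b, 0 < b → 2 * b < d → A (d - b) u = 0) (r : ℕ)
    (hr : 2 * r ≤ d) (j : ℕ) (hj : 2 * j ≤ r * (r + 1)) :
    ∃ w : V, w ≠ 0 ∧ G w = (μ * ζ ^ j) • w ∧ ∀ b, r < b → 2 * b < d → A (d - b) w = 0 := by
  induction r generalizing j with
  | zero =>
    obtain rfl : j = 0 := by omega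
    exact ⟨u, hu, by simpa using hGu, hlow⟩
  | succ r ih =>
    by_cases hj' : 2 * j ≤ r * (r + 1)
    · obtain ⟨w, hw, hGw, h⟩ := ih (by omega) j hj'
      exact ⟨w, hw, hGw, fun b hb => h b (by omega)⟩
    have hrj : r + 1 ≤ j := by
      by_contra h
      exact hj' (by nlinarith [show j ≤ r by omega, Nat.zero_le r, show r = 0 ∨ 1 ≤ r by omega,
        show r ≤ r * r from Nat.le_mul_self r])
    obtain ⟨w, hw, hGw, h⟩ := ih (by omega) (j - (r + 1)) (by
      have : j = j - (r + 1) + (r + 1) := by omega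
      nlinarith)
    refine ⟨A (r + 1) w, fun h0 => hw ?_, ?_, fun b hb hbd => ?_⟩
    · obtain hd | hd := hr.eq_or_lt
      · have := H.anticomm_apply (a := r + 1) (b := r + 1) (by omega) (by omega) (by omega)
          (by omega) w
        simpa [h0, ← two_mul, hd, H.ne_zero, eq_comm] using this
      · have := H.anticomm_apply (a := d - (r + 1)) (b := r + 1) (by omega) (by omega) (by omega)
          (by omega) w
        rw [h0, h _ (by omega) hd, if_pos (by omega)] at this
        simpa [H.ne_zero, eq_comm] using this
    · rw [H.apply_eq (by omega) (by omega) hGw, mul_assoc, ← pow_add, Nat.sub_add_cancel hrj]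
    · exact H.apply_apply_eq_zero (by omega) (by omega) (by omega) (by omega) (by omega)
        (h b (by omega) hbd)

/-- The eigenvalues of `G` contain long strings `μ ζ ^ s, μ ζ ^ (s + 1), …`. -/
theorem exists_hasEigenvalue (H : CliffordLadder d G A ζ κ) {μ : ℂ} (hμ : G.HasEigenvalue μ) :
    ∃ s : ℕ, ∀ j : ℕ, 2 * j ≤ d / 2 * (d / 2 + 1) → G.HasEigenvalue (μ * ζ ^ (s + j)) := by
  obtain ⟨u, hu⟩ := hμ.exists_hasEigenvector
  obtain ⟨s, w, hw, hGw, hlow⟩ := H.exists_lowest hu.2 hu.apply_eq_smul d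
  refine ⟨s, fun j hj => ?_⟩
  obtain ⟨x, hx, hGx, -⟩ := H.exists_raise hw hGw (fun b h1 h2 => hlow b h1 (by omega) h2)
    (d / 2) (by omega) j hj
  rw [mul_assoc, ← pow_add] at hGx
  exact End.hasEigenvalue_of_hasEigenvector ⟨End.mem_eigenspace_iff.2 hGx, hx⟩

/-- Unless `d` is `3` or `5`, the eigenvalues of `G` are closed under multiplication by powers
of `ζ`. -/
theorem hasEigenvalue_mul_pow (H : CliffordLadder d G A ζ κ) (hd : 0 < d) (hd3 : d ≠ 3)
    (hd5 : d ≠ 5) (hζ : ζ ^ d = 1) {μ : ℂ} (hμ : G.HasEigenvalue μ) (i : ℕ) :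
    G.HasEigenvalue (μ * ζ ^ i) := by
  obtain ⟨s, hs⟩ := H.exists_hasEigenvalue hμ
  obtain ⟨j, hj, hji⟩ := exists_lt_add_modEq hd s i
  rw [← pow_eq_pow_of_modEq hji hζ]
  refine hs j ?_
  obtain h | h : d < 6 ∨ 6 ≤ d := by omega
  · interval_cases d <;> omega
  · obtain ⟨m, hm | hm⟩ : ∃ m, d = 2 * m ∨ d = 2 * m + 1 := ⟨d / 2, by omega⟩
    · have : d / 2 = m := by omega
      rw [this]
      nlinarith [show 3 ≤ m by omega]
    · have : d / 2 = m := by omega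
      rw [this]
      nlinarith [show 3 ≤ m by omega]

/-- If `d` is `3` or `5`, multiplying an eigenvalue of `G` by the powers of `ζ` yields at most one
non-eigenvalue. -/
theorem hasEigenvalue_mul_pow_of_not (H : CliffordLadder d G A ζ κ) (hd : d = 3 ∨ d = 5)
    (hζ : ζ ^ d = 1) {μ : ℂ} (hμ : G.HasEigenvalue μ) {i₀ i : ℕ}
    (hi₀ : ¬ G.HasEigenvalue (μ * ζ ^ i₀)) (hi : ¬ i ≡ i₀ [MOD d]) :
    G.HasEigenvalue (μ * ζ ^ i) := by
  obtain ⟨s, hs⟩ := H.exists_hasEigenvalue hμ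
  obtain ⟨j, hj, hji⟩ := exists_lt_add_modEq (show 0 < d by omega) s i
  obtain ⟨j₀, hj₀, hji₀⟩ := exists_lt_add_modEq (show 0 < d by omega) s i₀
  rw [← pow_eq_pow_of_modEq hji hζ]
  rw [← pow_eq_pow_of_modEq hji₀ hζ] at hi₀
  have h1 : ¬ 2 * j₀ ≤ d / 2 * (d / 2 + 1) := fun h => hi₀ (hs j₀ h)
  have h2 : j ≠ j₀ := by
    rintro rfl
    exact hi (hji.symm.trans hji₀)
  refine hs j ?_
  rcases hd with rfl | rfl <;> omega

end CliffordLadder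

end Ladder

section CycleVector

open Finset Function

variable {α : Type*} [DecidableEq α]

/-- An eigenvector for the action of a permutation `σ`, supported on the orbit of `p`. -/
noncomputable def cycleVector (σ : Equiv.Perm α) (p : α) (ζ : ℂ) (a : ℕ) : α → ℂ :=
  fun i => ∑ j ∈ range (minimalPeriod σ p), if σ^[j] p = i then (ζ⁻¹ ^ a) ^ j else 0

variable {σ : Equiv.Perm α} {p : α} {ζ : ℂ}

theorem geom_sum_root_eq_zero {d : ℕ} (hζ : IsPrimitiveRoot ζ d) {a : ℕ} (ha : ¬ d ∣ a) :
    ∑ j ∈ range d, (ζ⁻¹ ^ a) ^ j = 0 := by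
  have h1 : ζ⁻¹ ^ a ≠ 1 := fun h => ha (hζ.inv.dvd_of_pow_eq_one a h)
  rw [geom_sum_eq h1, ← pow_mul, mul_comm, pow_mul, hζ.inv.pow_eq_one, one_pow, sub_self, zero_div]

theorem sum_cycleVector_mul [Fintype α] (a : ℕ) (f : α → ℂ) :
    ∑ i, cycleVector σ p ζ a i * f i =
      ∑ j ∈ range (minimalPeriod σ p), (ζ⁻¹ ^ a) ^ j * f (σ^[j] p) := by
  simp only [cycleVector, sum_mul]
  rw [sum_comm]
  simp [ite_mul]

theorem sum_cycleVector_mul_of_invariant [Fintype α]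
    (hζ : IsPrimitiveRoot ζ (minimalPeriod σ p)) {a : ℕ} (ha : ¬ minimalPeriod σ p ∣ a) {f : α → ℂ}
    (hf : ∀ i, f (σ i) = f i) : ∑ i, cycleVector σ p ζ a i * f i = 0 := by
  have : ∀ j, f (σ^[j] p) = f p := fun j => by
    induction j with
    | zero => rfl
    | succ j ih => rw [iterate_succ_apply', hf, ih]
  simp only [sum_cycleVector_mul, this, ← sum_mul, geom_sum_root_eq_zero hζ ha, zero_mul]

theorem sum_cycleVector [Fintype α]
    (hζ : IsPrimitiveRoot ζ (minimalPeriod σ p)) {a : ℕ} (ha : ¬ minimalPeriod σ p ∣ a) :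
    ∑ i, cycleVector σ p ζ a i = 0 := by
  simpa using sum_cycleVector_mul_of_invariant hζ ha (f := fun _ => 1) fun _ => rfl

theorem cycleVector_iterate {b j : ℕ} (hj : j < minimalPeriod σ p) :
    cycleVector σ p ζ b (σ^[j] p) = (ζ⁻¹ ^ b) ^ j := by
  rw [cycleVector, sum_eq_single j]
  · simp
  · intro i hi hij
    refine if_neg fun h => hij ?_
    exact iterate_injOn_Iio_minimalPeriod (mem_range.1 hi) hj h
  · intro h
    exact absurd (mem_range.2 hj) h

theorem sum_cycleVector_mul_cycleVector [Fintype α]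
    (hζ : IsPrimitiveRoot ζ (minimalPeriod σ p)) {a b : ℕ} (ha : 0 < a)
    (ha' : a < minimalPeriod σ p) (hb' : b < minimalPeriod σ p) :
    ∑ i, cycleVector σ p ζ a i * cycleVector σ p ζ b i =
      if a + b = minimalPeriod σ p then (minimalPeriod σ p : ℂ) else 0 := by
  rw [sum_cycleVector_mul, sum_congr rfl fun j hj => by
    rw [cycleVector_iterate (mem_range.1 hj), ← mul_pow, ← pow_add]]
  split_ifs with h
  · simp [h, hζ.inv.pow_eq_one]
  · refine geom_sum_root_eq_zero hζ fun hd => h ?_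
    obtain ⟨m, hm⟩ := hd
    have h2 : 0 < m := Nat.pos_of_ne_zero (by rintro rfl; omega)
    have h3 : m < 2 := by
      by_contra hm2
      have := Nat.mul_le_mul_left (minimalPeriod σ p) (not_lt.1 hm2)
      omega
    obtain rfl : m = 1 := by omega
    omega

theorem smul_cycleVector_apply (hζ : IsPrimitiveRoot ζ (minimalPeriod σ p))
    (hp : 0 < minimalPeriod σ p) (a : ℕ) (i : α) :
    (ζ ^ a • cycleVector σ p ζ a) (σ i) = cycleVector σ p ζ a i := by
  have hζ0 : ζ ≠ 0 := hζ.ne_zero hp.ne'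
  set F : ℕ → ℂ := fun j => if σ^[j] p = σ i then (ζ⁻¹ ^ a) ^ j else 0 with hF
  have hper : F (minimalPeriod σ p) = F 0 := by
    simp only [hF, iterate_minimalPeriod, iterate_zero, id, pow_zero]
    rw [← pow_mul, mul_comm, pow_mul, hζ.inv.pow_eq_one, one_pow]
  have hshift : ∑ j ∈ range (minimalPeriod σ p), F j =
      ∑ j ∈ range (minimalPeriod σ p), F (j + 1) := by
    have h1 := sum_range_succ F (minimalPeriod σ p)
    rw [sum_range_succ', hper] at h1
    exact (add_right_cancel h1).symm
  rw [Pi.smul_apply, cycleVector, hshift, cycleVector, smul_eq_mul, mul_sum]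
  refine sum_congr rfl fun j _ => ?_
  simp only [hF, iterate_succ_apply', σ.injective.eq_iff, mul_ite, mul_zero]
  split_ifs with h
  · rw [pow_succ, mul_left_comm, ← mul_pow, mul_inv_cancel₀ hζ0, one_pow, mul_one]
  · rfl

end CycleVector

namespace Schur

open Module Finset Function

variable {n : ℕ} {V : Type*} [AddCommGroup V] [Module ℂ V] {ρ : Cover n →* End ℂ V}

theorem cliff_smul (c : ℂ) (v : Fin n → ℂ) : cliff ρ (c • v) = c • cliff ρ v := by
  simp [cliff, smul_sum, mul_smul]

theorem exists_cliffordLadder {π : Cover n →* Equiv.Perm (Fin n)}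
    (hπt : ∀ i : Fin (n - 1), π (t n i) = adj n i) (hπz : π (z n) = 1) (hspin : ρ (z n) = -1)
    (hadj : ∀ i, i + 1 < n - 1 →
      ρ (gen n i) * ρ (gen n (i + 1)) + ρ (gen n (i + 1)) * ρ (gen n i) = 1) {g : Cover n}
    {f : Fin n → ℂ} (hf0 : ∑ i, f i = 0) (hf : ∀ i, f (π g i) = f i) (hff : ∑ i, f i * f i ≠ 0)
    {p : Fin n} {ζ : ℂ} (hζ : IsPrimitiveRoot ζ (minimalPeriod (π g) p))
    (hp : 0 < minimalPeriod (π g) p) :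
    ∃ (A : ℕ → End ℂ V) (κ : ℂ), CliffordLadder (minimalPeriod (π g) p) (ρ g) A ζ κ := by
  set v := cycleVector (π g) p ζ
  set d := minimalPeriod (π g) p
  have hv0 : ∀ a, 0 < a → a < d → ∑ i, v a i = 0 := fun a ha ha' =>
    sum_cycleVector hζ (Nat.not_dvd_of_pos_of_lt ha ha')
  have hvf : ∀ a, 0 < a → a < d → ∑ i, v a i * f i = 0 := fun a ha ha' =>
    sum_cycleVector_mul_of_invariant hζ (Nat.not_dvd_of_pos_of_lt ha ha') hf
  have hsign : (((Equiv.Perm.sign (π g) : ℤ) : ℂ) * ((Equiv.Perm.sign (π g) : ℤ) : ℂ)) = 1 := by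
    obtain h | h := Int.units_eq_one_or (Equiv.Perm.sign (π g)) <;> simp [h]
  have hfcl : cliff ρ f * cliff ρ f = (-(∑ i, f i * f i) / 2 : ℂ) • 1 := by
    have := cliff_anticommutator hspin hadj hf0 hf0
    rw [← two_smul ℂ] at this
    rw [← inv_smul_smul₀ (two_ne_zero (α := ℂ)) (cliff ρ f * cliff ρ f), this, smul_smul]
    congr 1
    ring
  have hanti : ∀ a, 0 < a → a < d → cliff ρ f * cliff ρ (v a) = -(cliff ρ (v a) * cliff ρ f) :=
    fun a ha ha' => by
      have := cliff_anticommutator hspin hadj (hv0 a ha ha') hf0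
      rw [hvf a ha ha', neg_zero, zero_smul] at this
      exact eq_neg_of_add_eq_zero_right this
  refine ⟨fun a => cliff ρ (v a) * cliff ρ f, -(d * ∑ i, f i * f i) / 2, ?_, fun a ha ha' => ?_,
    fun a b ha ha' hb hb' => ?_⟩
  · have : (d : ℂ) ≠ 0 := Nat.cast_ne_zero.2 hp.ne'
    simp [this, hff]
  · have h1 := cliff_equivariant hπt hπz hspin hadj g (hv0 a ha ha')
      (smul_cycleVector_apply hζ hp a)
    have h2 := cliff_equivariant hπt hπz hspin hadj g hf0 hf
    rw [← mul_assoc, h1, smul_mul_assoc, mul_assoc, h2, mul_smul_comm, smul_smul, hsign, one_smul,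
      cliff_smul, smul_mul_assoc, mul_assoc]
  · have h1 := cliff_anticommutator hspin hadj (hv0 a ha ha') (hv0 b hb hb')
    have h2 : ∀ a b, 0 < b → b < d → cliff ρ (v a) * cliff ρ f * (cliff ρ (v b) * cliff ρ f) =
        -(cliff ρ (v a) * cliff ρ (v b) * (cliff ρ f * cliff ρ f)) := fun a b hb hb' => by
      rw [mul_assoc, ← mul_assoc (cliff ρ f), hanti b hb hb']
      noncomm_ring
    rw [h2 a b hb hb', h2 b a ha ha', ← neg_add, ← add_mul, h1, hfcl,
      sum_cycleVector_mul_cycleVector hζ ha ha' hb', smul_mul_smul_comm, mul_one, ← neg_smul]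
    congr 1
    split_ifs
    · ring
    · simp

end Schur

namespace Schur

open Module

variable {n : ℕ} {V : Type*} [AddCommGroup V] [Module ℂ V] {ρ : Cover n →* End ℂ V}
  {π : Cover n →* Equiv.Perm (Fin n)}

theorem exists_hasEigenvalue_of_cycleType_eq (hn : 0 < n)
    (hπt : ∀ i : Fin (n - 1), π (t n i) = adj n i) (hπz : π (z n) = 1) (hspin : ρ (z n) = -1)
    {x y : Cover n} (hxy : (π x).cycleType = (π y).cycleType) {α : ℂ} (hα : α ^ 2 = 1)
    (h : (ρ x).HasEigenvalue α) : ∃ β : ℂ, β ^ 2 = 1 ∧ (ρ y).HasEigenvalue β := by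
  obtain ⟨τ, hτ⟩ := isConj_iff.1 (Equiv.Perm.isConj_iff_cycleType_eq.2 hxy)
  obtain ⟨w, rfl⟩ := proj_surjective hπt τ
  obtain ⟨v, hv⟩ := h.exists_hasEigenvector
  have hw : ρ w⁻¹ * ρ w = 1 := by rw [← map_mul, inv_mul_cancel, map_one]
  have hv0 : ρ w v ≠ 0 := fun h0 => hv.2 <| by
    simpa [h0, eq_comm] using LinearMap.congr_fun hw v
  have h1 : ρ (w * x * w⁻¹) (ρ w v) = α • ρ w v := by
    rw [← End.mul_apply, ← map_mul, inv_mul_cancel_right, map_mul, End.mul_apply, hv.apply_eq_smul,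
      map_smul]
  have h2 : π y = π (w * x * w⁻¹) := by rw [← hτ, map_mul, map_mul, map_inv]
  obtain h3 | h3 := eq_or_eq_z_mul hn hπt hπz h2
  · refine ⟨α, hα, End.hasEigenvalue_of_hasEigenvector ⟨End.mem_eigenspace_iff.2 ?_, hv0⟩⟩
    rw [h3, h1]
  · refine ⟨-α, by rw [neg_sq, hα],
      End.hasEigenvalue_of_hasEigenvector ⟨End.mem_eigenspace_iff.2 ?_, hv0⟩⟩
    rw [h3, map_mul, hspin, End.mul_apply, h1]
    simp

theorem not_hasEigenvalue_gen_mul_gen (hn : 2 < n) (hspin : ρ (z n) = -1)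
    (hadj : ∀ i, i + 1 < n - 1 →
      ρ (gen n i) * ρ (gen n (i + 1)) + ρ (gen n (i + 1)) * ρ (gen n i) = 1) {β : ℂ}
    (hβ : β ^ 2 = 1) : ¬ (ρ (gen n 0 * gen n 1)).HasEigenvalue β := by
  intro h
  obtain ⟨v, hv⟩ := h.exists_hasEigenvector
  have hS := spinSystem_of_spin hspin (N := n - 1) le_rfl (fun _ => 1)
  have h0 : ρ (gen n 0) * ρ (gen n 0) = -1 := hS.T_sq 0 (by omega)
  have h1 : ρ (gen n 1) * ρ (gen n 1) = -1 := hS.T_sq 1 (by omega)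
  have h2 := hadj 0 (by omega)
  rw [map_mul] at hv
  set a := ρ (gen n 0)
  set b := ρ (gen n 1)
  have hinv : b * a * (a * b) = 1 := by
    rw [mul_assoc, ← mul_assoc a a, h0, neg_one_mul, mul_neg, h1, neg_neg]
  have hv1 : (a * b) v = β • v := hv.apply_eq_smul
  have hv2 : (b * a) v = β • v := by
    have := LinearMap.congr_fun hinv v
    rw [End.mul_apply, hv1, map_smul, End.one_apply] at this
    rw [← one_smul ℂ ((b * a) v), ← hβ, sq, mul_smul, this]
  have hv3 := LinearMap.congr_fun h2 v
  change (a * b) v + (b * a) v = v at hv3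
  rw [hv1, hv2, ← add_smul] at hv3
  have : (β + β - 1) • v = 0 := by rw [sub_smul, hv3, one_smul, sub_self]
  have h4 := (smul_eq_zero.1 this).resolve_right hv.2
  have h5 : β = 1 / 2 := by linear_combination h4 / 2
  norm_num [h5] at hβ

theorem not_hasEigenvalue_gen_prod (hn : 4 < n) (hspin : ρ (z n) = -1)
    (hadj : ∀ i, i + 1 < n - 1 →
      ρ (gen n i) * ρ (gen n (i + 1)) + ρ (gen n (i + 1)) * ρ (gen n i) = 1) {β : ℂ}
    (hβ : β ^ 2 = 1) : ¬ (ρ (gen n 0 * gen n 1 * gen n 2 * gen n 3)).HasEigenvalue β := by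
  intro h
  obtain ⟨v, hv⟩ := h.exists_hasEigenvector
  have hS := spinSystem_of_spin hspin (N := n - 1) le_rfl (fun _ => 1)
  have h0 : ρ (gen n 0) * ρ (gen n 0) = -1 := hS.T_sq 0 (by omega)
  have h1 : ρ (gen n 1) * ρ (gen n 1) = -1 := hS.T_sq 1 (by omega)
  have h2 : ρ (gen n 2) * ρ (gen n 2) = -1 := hS.T_sq 2 (by omega)
  have h3 : ρ (gen n 3) * ρ (gen n 3) = -1 := hS.T_sq 3 (by omega)
  have key := basic_five_cycle h0 h1 h2 h3 (hadj 0 (by omega)) (hadj 1 (by omega))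
    (hadj 2 (by omega)) (hS.far 0 2 (by omega) (by omega)) (hS.far 0 3 (by omega) (by omega))
    (hS.far 1 3 (by omega) (by omega))
  simp only [map_mul] at hv
  dsimp only at key
  set a := ρ (gen n 0)
  set b := ρ (gen n 1)
  set c := ρ (gen n 2)
  set d := ρ (gen n 3)
  have hinv : d * c * b * a * (a * b * c * d) = 1 := by
    calc d * c * b * a * (a * b * c * d) = d * (c * (b * (a * a) * b) * c) * d := by noncomm_ring
      _ = 1 := by simp [h0, h1, h2, h3]
  have hv1 : (a * b * c * d) v = β • v := hv.apply_eq_smul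
  have hv2 : (d * c * b * a) v = β • v := by
    have := LinearMap.congr_fun hinv v
    rw [End.mul_apply, hv1, map_smul, End.one_apply] at this
    rw [← one_smul ℂ ((d * c * b * a) v), ← hβ, sq, mul_smul, this]
  have hv3 : (a * b * c * d + d * c * b * a) v = (β + β) • v := by
    rw [LinearMap.add_apply, hv1, hv2, add_smul]
  have hv4 := LinearMap.congr_fun key v
  rw [End.mul_apply, hv3, map_smul, hv3, LinearMap.add_apply, hv3, End.one_apply, smul_smul] at hv4
  have : ((β + β) * (β + β) - (β + β) - 1) • v = 0 := by
    rw [sub_smul, sub_smul, hv4, one_smul]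
    abel
  have h4 := (smul_eq_zero.1 this).resolve_right hv.2
  have h5 : β = 3 / 2 := by linear_combination -h4 / 2 + 2 * hβ
  norm_num [h5] at hβ

end Schur

theorem Equiv.Perm.cycleType_pow_eq_singleton {α : Type*} [Fintype α] [DecidableEq α]
    {σ : Equiv.Perm α} {q N : ℕ} {s : Multiset ℕ} (hσ : σ.cycleType = q ::ₘ s)
    (hs : ∀ d ∈ s, d ∣ N) (hN : N.Coprime q) : (σ ^ N).cycleType = {q} := by
  have hq : q ∈ σ.cycleType := by simp [hσ]
  rw [Equiv.Perm.cycleType_def, Multiset.mem_map] at hq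
  obtain ⟨c, hc, hcq⟩ := hq
  have hc' : c ∈ σ.cycleFactorsFinset := hc
  have hdisj := Equiv.Perm.disjoint_mul_inv_of_mem_cycleFactorsFinset hc'
  have hcyc := (Equiv.Perm.mem_cycleFactorsFinset_iff.1 hc').1
  have hcard : c.support.card = q := hcq
  have hmul : σ = σ * c⁻¹ * c := by simp
  have hct : (σ * c⁻¹).cycleType = s := by
    have := hdisj.cycleType_mul
    rw [← hmul, hcyc.cycleType, hcard, hσ, ← Multiset.singleton_add, add_comm] at this
    exact (add_right_cancel this).symm
  have h1 : (σ * c⁻¹) ^ N = 1 := by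
    rw [← orderOf_dvd_iff_pow_eq_one, ← Equiv.Perm.lcm_cycleType, hct]
    exact Multiset.lcm_dvd.2 hs
  have h2 : σ ^ N = c ^ N := by
    conv_lhs => rw [hmul]
    rw [hdisj.commute.mul_pow, h1, one_mul]
  have h3 : N.Coprime (orderOf c) := by rwa [hcyc.orderOf, hcard]
  rw [h2, (hcyc.pow_iff.2 h3).cycleType, Equiv.Perm.support_pow_coprime h3, hcard]

section RootsOfUnity

theorem exists_mul_of_pow_mul_eq_one {x : ℂ} {q N : ℕ} (hqN : q.Coprime N) (hx : x ^ (q * N) = 1) :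
    ∃ a b : ℂ, x = a * b ∧ a ^ q = 1 ∧ b ^ N = 1 := by
  obtain rfl | hx0 := eq_or_ne x 0
  · obtain rfl | hq := q.eq_zero_or_pos
    · exact ⟨0, 1, by simp⟩
    obtain rfl | hN := N.eq_zero_or_pos
    · exact ⟨1, 0, by simp⟩
    · rw [zero_pow (by positivity)] at hx
      exact absurd hx zero_ne_one
  refine ⟨x ^ (N * N.gcdA q : ℤ), x ^ (q * N.gcdB q : ℤ), ?_, ?_, ?_⟩
  · rw [← zpow_add₀ hx0, ← Nat.gcd_eq_gcd_ab, hqN.symm.gcd_eq_one, Nat.cast_one, zpow_one]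
  · rw [← zpow_natCast, ← zpow_mul, show (N * N.gcdA q * q : ℤ) = ((q * N : ℕ) : ℤ) * N.gcdA q by
      push_cast; ring, zpow_mul, zpow_natCast, hx, one_zpow]
  · rw [← zpow_natCast, ← zpow_mul, show (q * N.gcdB q * N : ℤ) = ((q * N : ℕ) : ℤ) * N.gcdB q by
      push_cast; ring, zpow_mul, zpow_natCast, hx, one_zpow]

theorem Subgroup.mem_of_pow_lcm_eq_one {G : Type*} [CommGroup G] (H : Subgroup G) {a b : ℕ}
    (ha : ∀ x : G, x ^ a = 1 → x ∈ H) (hb : ∀ x : G, x ^ b = 1 → x ∈ H) {x : G}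
    (hx : x ^ a.lcm b = 1) : x ∈ H := by
  obtain h0 | h0 := (a.gcd b).eq_zero_or_pos
  · obtain ⟨rfl, -⟩ := Nat.gcd_eq_zero_iff.1 h0
    exact ha x (pow_zero x)
  obtain ⟨a', b', hab, ha', hb'⟩ := Nat.exists_coprime a b
  have hlcm : a.lcm b = a.gcd b * a' * b' := by
    apply Nat.eq_of_mul_eq_mul_left h0
    rw [Nat.gcd_mul_lcm]
    exact (congrArg₂ (· * ·) ha' hb').trans (by ring)
  have h1 : x ^ b' ∈ H := ha _ <| by
    rw [← pow_mul, ← hx, hlcm]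
    nth_rw 1 [ha']
    ring_nf
  have h2 : x ^ a' ∈ H := hb _ <| by
    rw [← pow_mul, ← hx, hlcm]
    nth_rw 1 [hb']
    ring_nf
  have := H.mul_mem (H.zpow_mem h2 (a'.gcdA b')) (H.zpow_mem h1 (a'.gcdB b'))
  rwa [← zpow_natCast, ← zpow_mul, ← zpow_natCast, ← zpow_mul, ← zpow_add, ← Nat.gcd_eq_gcd_ab,
    hab.gcd_eq_one, Nat.cast_one, zpow_one] at this

theorem Subgroup.mem_of_pow_multiset_lcm_eq_one {G : Type*} [CommGroup G] (H : Subgroup G)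
    {s : Multiset ℕ} (hs : ∀ d ∈ s, ∀ x : G, x ^ d = 1 → x ∈ H) {x : G} (hx : x ^ s.lcm = 1) :
    x ∈ H := by
  induction s using Multiset.induction generalizing x with
  | empty =>
    rw [Multiset.lcm_zero, pow_one] at hx
    exact hx ▸ H.one_mem
  | cons a s ih =>
    rw [Multiset.lcm_cons] at hx
    exact H.mem_of_pow_lcm_eq_one (hs a (s.mem_cons_self a))
      (fun y hy => ih (fun d hd => hs d (Multiset.mem_cons_of_mem hd)) hy) hx

theorem mul_mem_of_pow_multiset_lcm_eq_one {S : Set ℂ} {s : Multiset ℕ} (h0 : s.lcm ≠ 0)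
    (hs : ∀ d ∈ s, ∀ x : ℂ, x ^ d = 1 → ∀ l ∈ S, l * x ∈ S) {x : ℂ} (hx : x ^ s.lcm = 1) {l : ℂ}
    (hl : l ∈ S) : l * x ∈ S := by
  let H : Subgroup ℂˣ :=
    { carrier := {u | ∀ l, l ∈ S ↔ l * u ∈ S}
      one_mem' := by simp
      mul_mem' := fun {u v} hu hv l => by rw [Units.val_mul, ← mul_assoc, ← hv, ← hu]
      inv_mem' := fun {u} hu l => by rw [hu (l * _), Units.inv_mul_cancel_right] }
  have hx0 : x ≠ 0 := by
    rintro rfl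
    rw [zero_pow h0] at hx
    exact zero_ne_one hx
  have hmem : Units.mk0 x hx0 ∈ H := by
    refine H.mem_of_pow_multiset_lcm_eq_one (s := s) (fun d hd u hu l => ?_)
      (Units.ext (by simpa using hx))
    have hu' : (u : ℂ) ^ d = 1 := by rw [← Units.val_pow_eq_pow_val, hu, Units.val_one]
    refine ⟨hs d hd u hu' l, fun h => ?_⟩
    have := hs d hd ↑u⁻¹ (by rw [← Units.val_pow_eq_pow_val, inv_pow, hu]; simp) _ h
    rwa [Units.mul_inv_cancel_right] at this
  exact (hmem l).1 hl

theorem mul_mem_of_pow_ne {S : Set ℂ} {q N : ℕ} {e : ℂ} (hq : 1 < q) (hN : N.Coprime q)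
    (he0 : e ≠ 0) (he : e ^ q = e) (hS : ∀ l ∈ S, l ^ (q * N) = e ∧ l ^ N ≠ e)
    (hmul : ∀ l ∈ S, ∀ x y : ℂ, x ^ q = 1 → y ^ q = 1 → x ≠ y → l * x ∉ S → l * y ∈ S) {l : ℂ}
    (hl : l ∈ S) {x : ℂ} (hx : x ^ q = 1) (hlx : (l * x) ^ N ≠ e) : l * x ∈ S := by
  obtain ⟨m, hm⟩ := Nat.exists_mul_mod_eq_one_of_coprime hN hq
  have hl0 : l ^ N ≠ 0 := fun h => he0 <| by
    rw [← (hS l hl).1, mul_comm, pow_mul, h, zero_pow (by omega)]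
  set w := e / l ^ N with hw
  have hwq : w ^ q = 1 := by
    rw [hw, div_pow, he, ← pow_mul, mul_comm, (hS l hl).1, div_self he0]
  have hwN : (w ^ m) ^ N = w := by
    rw [← pow_mul, mul_comm, ← Nat.div_add_mod (N * m) q, hm.2, pow_add, pow_mul, hwq, one_pow,
      one_mul, pow_one]
  have hbad : (l * w ^ m) ^ N = e := by
    rw [mul_pow, hwN, hw, mul_div_cancel₀ _ hl0]
  refine hmul l hl (w ^ m) x (by rw [← pow_mul, mul_comm, pow_mul, hwq, one_pow]) hx ?_ ?_
  · rintro rfl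
    exact hlx hbad
  · exact fun h => (hS _ h).2 hbad

theorem mem_iff_of_closed {S : Set ℂ} {s : Multiset ℕ} {m : ℕ} {e : ℂ} (hm : s.lcm = m)
    (hm0 : m ≠ 0) (h3m : m.Coprime 3) (h5m : m.Coprime 5) (he : e ^ 2 = 1)
    (hne : S.Nonempty)
    (hS : ∀ l ∈ S, l ^ (15 * m) = e ∧ l ^ (5 * m) ≠ e ∧ l ^ (3 * m) ≠ e)
    (hs : ∀ d ∈ s, ∀ x : ℂ, x ^ d = 1 → ∀ l ∈ S, l * x ∈ S)
    (h3 : ∀ l ∈ S, ∀ x y : ℂ, x ^ 3 = 1 → y ^ 3 = 1 → x ≠ y → l * x ∉ S → l * y ∈ S)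
    (h5 : ∀ l ∈ S, ∀ x y : ℂ, x ^ 5 = 1 → y ^ 5 = 1 → x ≠ y → l * x ∉ S → l * y ∈ S) (l : ℂ) :
    l ∈ S ↔ l ^ (15 * m) = e ∧ l ^ (5 * m) ≠ e ∧ l ^ (3 * m) ≠ e := by
  refine ⟨hS l, fun ⟨h15, hl5, hl3⟩ => ?_⟩
  obtain ⟨r, hr⟩ := hne
  have he0 : e ≠ 0 := by
    rintro rfl
    norm_num at he
  have hr0 : r ≠ 0 := by
    rintro rfl
    exact he0 (by rw [← (hS 0 hr).1, zero_pow (by omega)])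
  have hx : (l / r) ^ (3 * (5 * m)) = 1 := by
    rw [← mul_assoc, show 3 * 5 * m = 15 * m by norm_num, div_pow, h15, (hS r hr).1, div_self he0]
  obtain ⟨a, x, hax, ha, hx⟩ := exists_mul_of_pow_mul_eq_one
    (Nat.Coprime.mul_right (by norm_num) h3m.symm) hx
  obtain ⟨b, c, rfl, hb, hc⟩ := exists_mul_of_pow_mul_eq_one h5m.symm hx
  obtain rfl : l = r * a * b * c := by
    rw [div_eq_iff hr0] at hax
    rw [hax]
    ring
  have hb' : b ^ (5 * m) = 1 := by rw [pow_mul, hb, one_pow]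
  have hc5 : c ^ (5 * m) = 1 := by rw [mul_comm, pow_mul, hc, one_pow]
  have hc3 : c ^ (3 * m) = 1 := by rw [mul_comm, pow_mul, hc, one_pow]
  refine mul_mem_of_pow_multiset_lcm_eq_one (hm ▸ hm0) hs (hm ▸ hc) ?_
  refine mul_mem_of_pow_ne (q := 5) (N := 3 * m) (by norm_num)
    (Nat.Coprime.mul_left (by norm_num) h5m) he0 (by linear_combination (e ^ 3 + e) * he)
    (fun l hl => ⟨?_, (hS l hl).2.2⟩) h5 ?_ hb ?_
  · rw [← mul_assoc, show 5 * 3 * m = 15 * m by norm_num, (hS l hl).1]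
  · refine mul_mem_of_pow_ne (q := 3) (N := 5 * m) (by norm_num)
      (Nat.Coprime.mul_left (by norm_num) h3m) he0 (by linear_combination e * he)
      (fun l hl => ⟨?_, (hS l hl).2.1⟩) h3 hr ha ?_
    · rw [← mul_assoc, show 3 * 5 * m = 15 * m by norm_num, (hS l hl).1]
    · rwa [mul_pow, mul_pow _ b, hc5, hb', mul_one, mul_one] at hl5
  · rwa [mul_pow, hc3, mul_one] at hl3

end RootsOfUnity

section MinimalPolynomial

open Polynomial

theorem count_roots_X_pow_sub_C {N : ℕ} (hN : N ≠ 0) {e : ℂ} (he : e ≠ 0) (a : ℂ)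
    [Decidable (a ^ N = e)] : (X ^ N - C e).roots.count a = if a ^ N = e then 1 else 0 := by
  have hnd : (X ^ N - C e).roots.Nodup :=
    nodup_roots (separable_X_pow_sub_C e (Nat.cast_ne_zero.2 hN) he)
  have hmem : a ∈ (X ^ N - C e).roots ↔ a ^ N = e := mem_nthRoots (Nat.pos_of_ne_zero hN)
  split_ifs with h
  · exact Multiset.count_eq_one_of_mem hnd (hmem.2 h)
  · exact Multiset.count_eq_zero_of_notMem (mt hmem.1 h)

theorem mul_X_pow_sub_C_eq {p : ℂ[X]} {m : ℕ} {e : ℂ} (hm : m ≠ 0) (he : e ^ 2 = 1)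
    (hp : p.Monic) (hdvd : p ∣ X ^ (15 * m) - C e)
    (hroot : ∀ a, p.IsRoot a ↔ a ^ (15 * m) = e ∧ a ^ (5 * m) ≠ e ∧ a ^ (3 * m) ≠ e) :
    p * (X ^ (5 * m) - C e) * (X ^ (3 * m) - C e) =
      (X ^ (15 * m) - C e) * (X ^ m - C e) := by
  classical
  have he0 : e ≠ 0 := by
    rintro rfl
    norm_num at he
  have hmon : ∀ N, N ≠ 0 → (X ^ N - C e).Monic := fun N hN => monic_X_pow_sub_C e hN
  have h1 : (15 * m) ≠ 0 := by omega
  have h2 : (5 * m) ≠ 0 := by omega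
  have h3 : (3 * m) ≠ 0 := by omega
  have hL := (hp.mul (hmon _ h2)).mul (hmon _ h3)
  have hR := (hmon _ h1).mul (hmon _ hm)
  rw [(IsAlgClosed.splits _).eq_prod_roots_of_monic hL,
    (IsAlgClosed.splits _).eq_prod_roots_of_monic hR]
  congr 2
  rw [roots_mul hL.ne_zero, roots_mul (hp.mul (hmon _ h2)).ne_zero, roots_mul hR.ne_zero]
  ext a
  have hpa : p.roots.count a =
      if a ^ (15 * m) = e ∧ a ^ (5 * m) ≠ e ∧ a ^ (3 * m) ≠ e then 1 else 0 := by
    have hnd : p.roots.Nodup := nodup_roots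
      ((separable_X_pow_sub_C e (Nat.cast_ne_zero.2 h1) he0).of_dvd hdvd)
    have hmem : a ∈ p.roots ↔ _ := (mem_roots hp.ne_zero).trans (hroot a)
    split_ifs with h
    · exact Multiset.count_eq_one_of_mem hnd (hmem.2 h)
    · exact Multiset.count_eq_zero_of_notMem (mt hmem.1 h)
  simp only [Multiset.count_add, hpa, count_roots_X_pow_sub_C h1 he0,
    count_roots_X_pow_sub_C h2 he0, count_roots_X_pow_sub_C h3 he0, count_roots_X_pow_sub_C hm he0]
  simp only [mul_comm _ m, pow_mul]
  set y := a ^ m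
  have e3 : e ^ 3 = e := by linear_combination e * he
  have e5 : e ^ 5 = e := by linear_combination (e ^ 3 + e) * he
  have c3 : y ^ 3 = e → y ^ 15 = e := fun h => by
    rw [show 15 = 3 * 5 by norm_num, pow_mul, h, e5]
  have c5 : y ^ 5 = e → y ^ 15 = e := fun h => by
    rw [show 15 = 5 * 3 by norm_num, pow_mul, h, e3]
  have c1 : y = e ↔ y ^ 3 = e ∧ y ^ 5 = e := by
    refine ⟨fun h => by simp [h, e3, e5], fun ⟨h, h'⟩ => ?_⟩
    have hy2 : e * (y ^ 2 - 1) = 0 := by linear_combination h' - y ^ 2 * h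
    have hy2' := (mul_eq_zero.1 hy2).resolve_left he0
    linear_combination h - y * hy2'
  by_cases h : y ^ 3 = e <;> by_cases h' : y ^ 5 = e <;> simp_all

end MinimalPolynomial

section CycleType

open Equiv Function

variable {α : Type*} [Fintype α] [DecidableEq α]

theorem minimalPeriod_eq_card_support {σ c : Perm α} (hc : c ∈ σ.cycleFactorsFinset) {p : α}
    (hp : p ∈ c.support) : minimalPeriod σ p = c.support.card := by
  have hcyc := Perm.cycle_is_cycleOf hp hc
  have hon := σ.isCycleOn_support_cycleOf p
  rw [← hcyc] at hon
  refine Nat.dvd_right_iff_eq.1 fun m => ?_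
  rw [← isPeriodicPt_iff_minimalPeriod_dvd, ← hon.pow_apply_eq hp, IsPeriodicPt, IsFixedPt,
    ← Perm.iterate_eq_pow]

theorem exists_minimalPeriod_eq {σ : Perm α} {d : ℕ} (hd : d ∈ σ.cycleType) :
    ∃ p, minimalPeriod σ p = d := by
  rw [Perm.cycleType_def, Multiset.mem_map] at hd
  obtain ⟨c, hc, rfl⟩ := hd
  obtain ⟨p, hp⟩ := (Perm.mem_cycleFactorsFinset_iff.1 (show c ∈ σ.cycleFactorsFinset from hc)
    ).1.nonempty_support
  exact ⟨p, minimalPeriod_eq_card_support hc hp⟩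

theorem exists_invariant_sum_eq_zero {σ : Perm α} {p q : ℕ} (hp : p ∈ σ.cycleType)
    (hq : q ∈ σ.cycleType) (hpq : p ≠ q) :
    ∃ f : α → ℂ, ∑ i, f i = 0 ∧ (∀ i, f (σ i) = f i) ∧ ∑ i, f i * f i ≠ 0 := by
  have hp0 := Perm.two_le_of_mem_cycleType hp
  have hq0 := Perm.two_le_of_mem_cycleType hq
  rw [Perm.cycleType_def, Multiset.mem_map] at hp hq
  obtain ⟨c, hc, hcp⟩ := hp
  obtain ⟨c', hc', hcq⟩ := hq
  have hne : c ≠ c' := by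
    rintro rfl
    exact hpq (hcp.symm.trans hcq)
  have hdisj := (σ.cycleFactorsFinset_pairwise_disjoint hc hc' hne).disjoint_support
  simp only [comp_apply] at hcp hcq
  refine ⟨fun i => q * (if i ∈ c.support then 1 else 0) - p * (if i ∈ c'.support then 1 else 0),
    ?_, fun i => ?_, ?_⟩
  · simp only [Finset.sum_sub_distrib, ← Finset.mul_sum, Finset.sum_ite_mem, Finset.univ_inter,
      Finset.sum_const, nsmul_eq_mul, hcp, hcq]
    ring
  · simp only [Perm.mem_cycleFactorsFinset_support (show c ∈ σ.cycleFactorsFinset from hc),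
      Perm.mem_cycleFactorsFinset_support (show c' ∈ σ.cycleFactorsFinset from hc')]
  · have key : ∀ i, ((q * (if i ∈ c.support then 1 else 0) -
        p * (if i ∈ c'.support then 1 else 0)) * (q * (if i ∈ c.support then 1 else 0) -
        p * (if i ∈ c'.support then 1 else 0)) : ℂ) = q ^ 2 * (if i ∈ c.support then 1 else 0) +
        p ^ 2 * (if i ∈ c'.support then 1 else 0) := fun i => by
      by_cases h : i ∈ c.support
      · rw [if_pos h, if_neg (Finset.disjoint_left.1 hdisj h)]
        ring
      · rw [if_neg h]
        split_ifs <;> ring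
    simp only [key, Finset.sum_add_distrib, ← Finset.mul_sum, Finset.sum_ite_mem,
      Finset.univ_inter, Finset.sum_const, nsmul_eq_mul, hcp, hcq]
    norm_cast
    positivity

theorem cycleType_formPerm_of_nodup {l : List α} (hl : l.Nodup) (h2 : 2 ≤ l.length) :
    l.formPerm.cycleType = {l.length} := by
  rw [(List.isCycle_formPerm hl h2).cycleType, List.support_formPerm_of_nodup l hl,
    List.toFinset_card_of_nodup hl]
  rintro x rfl
  simp at h2

theorem Multiset.coprime_lcm_left {s : Multiset ℕ} {q : ℕ} (h : ∀ d ∈ s, d.Coprime q) :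
    s.lcm.Coprime q :=
  Nat.Coprime.coprime_dvd_left (Multiset.lcm_dvd.2 fun _ => Multiset.dvd_prod)
    (Nat.coprime_multiset_prod_left_iff.2 h)

end CycleType

namespace Schur

open Module Polynomial

variable {n : ℕ} {V : Type*} [AddCommGroup V] [Module ℂ V] {ρ : Cover n →* End ℂ V}
  {π : Cover n →* Equiv.Perm (Fin n)}

theorem cycleType_proj_gen_mul_gen (hn : 2 < n) (hπt : ∀ i : Fin (n - 1), π (t n i) = adj n i) :
    (π (gen n 0 * gen n 1)).cycleType = {3} := by
  have : π (gen n 0 * gen n 1) =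
      [(⟨0, by omega⟩ : Fin n), ⟨1, by omega⟩, ⟨2, by omega⟩].formPerm := by
    simp only [map_mul, proj_gen hπt (show 0 < n - 1 by omega),
      proj_gen hπt (show 1 < n - 1 by omega), List.formPerm_cons_cons, List.formPerm_singleton,
      mul_one]
  rw [this, cycleType_formPerm_of_nodup (by simp) (by simp)]
  rfl

theorem cycleType_proj_gen_prod (hn : 4 < n) (hπt : ∀ i : Fin (n - 1), π (t n i) = adj n i) :
    (π (gen n 0 * gen n 1 * gen n 2 * gen n 3)).cycleType = {5} := by
  have : π (gen n 0 * gen n 1 * gen n 2 * gen n 3) =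
      [(⟨0, by omega⟩ : Fin n), ⟨1, by omega⟩, ⟨2, by omega⟩, ⟨3, by omega⟩,
        ⟨4, by omega⟩].formPerm := by
    simp only [map_mul, proj_gen hπt (show 0 < n - 1 by omega),
      proj_gen hπt (show 1 < n - 1 by omega), proj_gen hπt (show 2 < n - 1 by omega),
      proj_gen hπt (show 3 < n - 1 by omega), List.formPerm_cons_cons, List.formPerm_singleton,
      mul_one, mul_assoc]
  rw [this, cycleType_formPerm_of_nodup (by simp) (by simp)]
  rfl

theorem pow_ne_of_cycleType_eq (hn : 0 < n) (hπt : ∀ i : Fin (n - 1), π (t n i) = adj n i)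
    (hπz : π (z n) = 1) (hspin : ρ (z n) = -1) {g y : Cover n} {q N : ℕ} {s : Multiset ℕ}
    (hg : (π g).cycleType = q ::ₘ s) (hs : ∀ d ∈ s, d ∣ N) (hN : N.Coprime q)
    (hy : (π y).cycleType = {q}) (hyρ : ∀ β : ℂ, β ^ 2 = 1 → ¬ (ρ y).HasEigenvalue β) {l e : ℂ}
    (he : e ^ 2 = 1) (hl : (ρ g).HasEigenvalue l) : l ^ N ≠ e := by
  rintro rfl
  have h1 : (ρ (g ^ N)).HasEigenvalue (l ^ N) := by
    rw [map_pow]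
    exact hl.pow N
  obtain ⟨β, hβ, h⟩ := exists_hasEigenvalue_of_cycleType_eq hn hπt hπz hspin (y := y)
    (by rw [map_pow, Equiv.Perm.cycleType_pow_eq_singleton hg hs hN, hy]) he h1
  exact hyρ β hβ h

end Schur

open Schur Polynomial in
/-- Theorem: for `n > 8`, `(ρ, V)` a basic spin representation of `S̃_n` (an irreducible
spin representation of dimension `2^⌊(n−1)/2⌋`) and `g ∈ S̃_n` such that `π(g)` has one
cycle of length 3 and one of length 5 while every other cycle has length divisible by
neither 3 nor 5 (so the cycles of length divisible by 3 or 5 are exactly one 3-cycle and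
one 5-cycle), one has `15 ∣ k` and the minimal polynomial of `ρ(g)` is
`(X^k − ε_g)(X^{k/15} − ε_g)/((X^{k/3} − ε_g)(X^{k/5} − ε_g))`, where `k` is the order
of `π(g)`. -/
theorem schur_basic_spin_minpoly_three_and_five (n : ℕ) (hn : 8 < n)
    (π : Cover n →* Equiv.Perm (Fin n))
    (hπt : ∀ i : Fin (n - 1), π (t n i) = adj n i)
    (hπz : π (z n) = 1)
    (g : Cover n) (k : ℕ) (hk : k = orderOf (π g))
    (hcyc : (π g).cycleType.filter (fun l => 3 ∣ l ∨ 5 ∣ l) = {3, 5})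
    (V : Type) [AddCommGroup V] [Module ℂ V] [FiniteDimensional ℂ V] [Nontrivial V]
    (ρ : Cover n →* Module.End ℂ V)
    (hirr : ∀ U : Submodule ℂ V, (∀ h : Cover n, U.map (ρ h) ≤ U) → U = ⊥ ∨ U = ⊤)
    (hspin : ρ (z n) = -1)
    (hdim : Module.finrank ℂ V = 2 ^ ((n - 1) / 2))
    (ε : ℂ) (hε : (g ^ k = 1 ∧ ε = 1) ∨ (g ^ k = z n ∧ ε = -1)) :
    15 ∣ k ∧
      minpoly ℂ (ρ g) * (X ^ (k / 3) - C ε) * (X ^ (k / 5) - C ε) =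
        (X ^ k - C ε) * (X ^ (k / 15) - C ε) := by
  have hadj := fun i hi => gen_anticommutator_of_finrank hn hπt hπz hspin hdim (i := i) hi
  have he : ε ^ 2 = 1 := by
    obtain ⟨-, rfl⟩ | ⟨-, rfl⟩ := hε <;> norm_num
  have hpow : ρ g ^ k = ε • 1 := by
    rw [← map_pow]
    obtain ⟨h, rfl⟩ | ⟨h, rfl⟩ := hε <;> simp [h, hspin]
  set s := (π g).cycleType.filter (fun l => ¬ (3 ∣ l ∨ 5 ∣ l)) with hs
  have hct : (π g).cycleType = {3, 5} + s := by
    rw [← hcyc, hs, Multiset.filter_add_not]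
  have hmem : ∀ d ∈ s, d ∈ (π g).cycleType ∧ ¬ 3 ∣ d ∧ ¬ 5 ∣ d := fun d hd => by
    simpa only [hs, Multiset.mem_filter, not_or] using hd
  have h3m : s.lcm.Coprime 3 := Multiset.coprime_lcm_left fun d hd =>
    ((Nat.Prime.coprime_iff_not_dvd (by norm_num)).2 (hmem d hd).2.1).symm
  have h5m : s.lcm.Coprime 5 := Multiset.coprime_lcm_left fun d hd =>
    ((Nat.Prime.coprime_iff_not_dvd (by norm_num)).2 (hmem d hd).2.2).symm
  have hkm : k = 15 * s.lcm := by
    rw [hk, ← Equiv.Perm.lcm_cycleType, hct, Multiset.lcm_add,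
      show Multiset.lcm {3, 5} = 15 by rfl]
    exact (Nat.Coprime.mul_left h3m.symm h5m.symm : Nat.Coprime (3 * 5) s.lcm).lcm_eq_mul
  obtain ⟨m, hm⟩ : ∃ m, s.lcm = m := ⟨_, rfl⟩
  rw [hm] at h3m h5m hkm
  have hm0 : m ≠ 0 := by
    have := orderOf_pos (π g)
    omega
  have h3c : 3 ∈ (π g).cycleType := by simp [hct]
  have h5c : 5 ∈ (π g).cycleType := by simp [hct]
  obtain ⟨f, hf0, hf, hff⟩ := exists_invariant_sum_eq_zero h3c h5c (by norm_num)
  have ladder : ∀ d ∈ (π g).cycleType, ∀ ζ, IsPrimitiveRoot ζ d →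
      ∃ A κ, CliffordLadder d (ρ g) A ζ κ := fun d hd ζ hζ => by
    obtain ⟨p, rfl⟩ := exists_minimalPeriod_eq hd
    exact exists_cliffordLadder hπt hπz hspin hadj hf0 hf hff hζ
      (two_pos.trans_le (Equiv.Perm.two_le_of_mem_cycleType hd))
  have hexc : ∀ q, q ∈ (π g).cycleType → q = 3 ∨ q = 5 → ∀ l ∈ {l | (ρ g).HasEigenvalue l},
      ∀ x y : ℂ, x ^ q = 1 → y ^ q = 1 → x ≠ y → l * x ∉ {l | (ρ g).HasEigenvalue l} →
      l * y ∈ {l | (ρ g).HasEigenvalue l} := fun q hq hq' l hl x y hx hy hxy hlx => by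
    have hq0 : q ≠ 0 := by omega
    have hζ := Complex.isPrimitiveRoot_exp q hq0
    have : NeZero q := ⟨hq0⟩
    obtain ⟨A, κ, H⟩ := ladder q hq _ hζ
    obtain ⟨i, -, rfl⟩ := hζ.eq_pow_of_pow_eq_one hx
    obtain ⟨j, -, rfl⟩ := hζ.eq_pow_of_pow_eq_one hy
    exact H.hasEigenvalue_mul_pow_of_not hq' hζ.pow_eq_one hl hlx fun h =>
      hxy (pow_eq_pow_of_modEq h.symm hζ.pow_eq_one)
  have hclosed : ∀ d ∈ s, ∀ x : ℂ, x ^ d = 1 → ∀ l ∈ {l | (ρ g).HasEigenvalue l},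
      l * x ∈ {l | (ρ g).HasEigenvalue l} := fun d hd x hx l hl => by
    obtain ⟨hd', hd3, hd5⟩ := hmem d hd
    have hd0 : d ≠ 0 := by
      have := Equiv.Perm.two_le_of_mem_cycleType hd'
      omega
    have hζ := Complex.isPrimitiveRoot_exp d hd0
    have : NeZero d := ⟨hd0⟩
    obtain ⟨A, κ, H⟩ := ladder d hd' _ hζ
    obtain ⟨i, -, rfl⟩ := hζ.eq_pow_of_pow_eq_one hx
    exact H.hasEigenvalue_mul_pow (Nat.pos_of_ne_zero hd0) (by rintro rfl; simp at hd3)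
      (by rintro rfl; simp at hd5) hζ.pow_eq_one hl i
  have hbound : ∀ l ∈ {l | (ρ g).HasEigenvalue l},
      l ^ (15 * m) = ε ∧ l ^ (5 * m) ≠ ε ∧ l ^ (3 * m) ≠ ε := fun l hl => by
    refine ⟨?_, ?_, ?_⟩
    · obtain ⟨v, hv⟩ := (Module.End.HasEigenvalue.pow hl k).exists_hasEigenvector
      have := hv.apply_eq_smul
      rw [hpow, hkm] at this
      exact (smul_left_injective ℂ hv.2 this).symm
    · refine pow_ne_of_cycleType_eq (q := 3) (s := 5 ::ₘ s) (by omega) hπt hπz hspin hct ?_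
        (Nat.Coprime.mul_left (by norm_num) h3m) (cycleType_proj_gen_mul_gen (by omega) hπt)
        (fun β hβ => not_hasEigenvalue_gen_mul_gen (by omega) hspin hadj hβ) he hl
      simp only [Multiset.mem_cons, forall_eq_or_imp, dvd_mul_right, true_and, ← hm]
      exact fun d hd => (Multiset.dvd_lcm hd).mul_left 5
    · refine pow_ne_of_cycleType_eq (q := 5) (s := 3 ::ₘ s) (by omega) hπt hπz hspin
        (hct.trans (Multiset.cons_swap 3 5 s)) ?_
        (Nat.Coprime.mul_left (by norm_num) h5m) (cycleType_proj_gen_prod (by omega) hπt)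
        (fun β hβ => not_hasEigenvalue_gen_prod (by omega) hspin hadj hβ) he hl
      simp only [Multiset.mem_cons, forall_eq_or_imp, dvd_mul_right, true_and, ← hm]
      exact fun d hd => (Multiset.dvd_lcm hd).mul_left 3
  refine ⟨⟨m, hkm⟩, ?_⟩
  rw [show k / 3 = 5 * m by omega, show k / 5 = 3 * m by omega, show k / 15 = m by omega, hkm]
  refine mul_X_pow_sub_C_eq hm0 he (minpoly.monic (Algebra.IsIntegral.isIntegral (ρ g))) ?_
    fun a => ?_
  · refine minpoly.dvd ℂ _ ?_
    rw [← hkm, map_sub, map_pow, aeval_X, aeval_C, hpow, Algebra.algebraMap_eq_smul_one, sub_self]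
  · rw [← Module.End.hasEigenvalue_iff_isRoot]
    exact mem_iff_of_closed hm hm0 h3m h5m he (Module.End.exists_eigenvalue (ρ g)) hbound hclosed
      (hexc 3 h3c (Or.inl rfl)) (hexc 5 h5c (Or.inr rfl)) a
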